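/- arXiv:0904.2756 — 2 statements merged into one kernel-verified Lean document; each statement's English description precedes it below -/
import Mathlib

section
/- Let n ≥ 5 and let K be a real number with K > max_{0≤t≤ω} |P_0(t)|. Suppose that for all t ∈ [0,ω] and for every index i with i ≠ 0, 1 (including i = n−1): |P_i(t)| ≤ (K − |P_0(t)|)·sin(π/(n−2)) / ((n−3)·K^{i/n}), and |P_1(t)| ≥ (K + |P_0(t)| + |P_{n−1}(t)| + (K − |P_0(t)|)·sin(π/(n−2))) / K^{1/n}. Then equation (1.1) has at most two positive real periodic solutions and at most two negative real periodic solutions. -/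
open Set Real Filter

noncomputable section

/-- Right-hand side of the real equation (2.1):
`x^n + P_{n-1}(t) x^{n-1} + ⋯ + P_1(t) x + P_0(t)`. -/
def fR (n : ℕ) (P : Fin n → ℝ → ℝ) (x t : ℝ) : ℝ :=
  x ^ n + ∑ i : Fin n, P i t * x ^ (i : ℕ)

/-- `x` is a real periodic solution of (1.1): it solves the equation on all of
`[0, ω]` and satisfies `x 0 = x ω`. -/
def IsPeriodicSolR (n : ℕ) (ω : ℝ) (P : Fin n → ℝ → ℝ) (x : ℝ → ℝ) : Prop :=
  (∀ t ∈ Icc (0:ℝ) ω, HasDerivWithinAt x (fR n P (x t) t) (Icc (0:ℝ) ω) t) ∧ x 0 = x ω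

/-- If `h` takes equal values at the endpoints and is decreasing whenever it meets the level `c`,
then it stays strictly on one side of `c`. -/
theorem forall_lt_or_forall_gt_of_deriv_neg {ω : ℝ} (hω : 0 < ω) {h h' : ℝ → ℝ} {c : ℝ}
    (hd : ∀ t ∈ Icc (0:ℝ) ω, HasDerivWithinAt h (h' t) (Icc (0:ℝ) ω) t)
    (hper : h 0 = h ω) (hneg : ∀ t ∈ Icc (0:ℝ) ω, h t = c → h' t < 0) :
    (∀ t ∈ Icc (0:ℝ) ω, h t < c) ∨ (∀ t ∈ Icc (0:ℝ) ω, c < h t) := by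
  have hcont : ContinuousOn h (Icc 0 ω) := fun t ht => (hd t ht).continuousWithinAt
  have hle : ∀ a ∈ Icc (0:ℝ) ω, h a ≤ c → ∀ t ∈ Icc a ω, h t ≤ c := by
    intro a ha hac t ht
    refine image_le_of_deriv_right_lt_deriv_boundary' (f' := h') (B := fun _ => c)
      (B' := fun _ => 0) (hcont.mono (Icc_subset_Icc_left ha.1)) ?_ hac continuousOn_const
      (fun x _ => hasDerivWithinAt_const _ _ _) ?_ ht
    · intro x hx
      have hx' : x ∈ Icc (0:ℝ) ω := ⟨ha.1.trans hx.1, hx.2.le⟩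
      refine (hd x hx').mono_of_mem_nhdsWithin ?_
      exact mem_of_superset (Icc_mem_nhdsGE hx.2) (Icc_subset_Icc_left hx'.1)
    · intro x hx hxc
      exact hneg x ⟨ha.1.trans hx.1, hx.2.le⟩ hxc
  have hne : (∀ t ∈ Icc (0:ℝ) ω, h t ≤ c) → ∀ t ∈ Ioc (0:ℝ) ω, h t ≠ c := by
    intro hall t ht htc
    have ht' : t ∈ Icc (0:ℝ) ω := Ioc_subset_Icc_self ht
    have hd' : HasDerivWithinAt h (h' t) (Icc 0 t) t :=
      (hd t ht').mono (Icc_subset_Icc_right ht.2)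
    have hslope := hasDerivWithinAt_iff_tendsto_slope.1 hd'
    have hnb : (nhdsWithin t (Icc 0 t \ {t})).NeBot := by
      rw [Icc_sdiff_right]
      exact right_nhdsWithin_Ico_neBot ht.1
    have : 0 ≤ h' t := by
      refine ge_of_tendsto hslope ?_
      filter_upwards [self_mem_nhdsWithin] with s hs
      have hst : s < t := lt_of_le_of_ne hs.1.2 hs.2
      have h1 := hall s ⟨hs.1.1, hs.1.2.trans ht.2⟩
      rw [slope_def_field]
      exact div_nonneg_of_nonpos (by linarith) (by linarith)
    exact absurd (hneg t ht' htc) (not_lt.2 this)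
  have h0 : (0:ℝ) ∈ Icc (0:ℝ) ω := ⟨le_rfl, hω.le⟩
  rcases le_or_gt (h 0) c with hc | hc
  · left
    have hall := hle 0 h0 hc
    intro t ht
    refine lt_of_le_of_ne (hall t ht) ?_
    rcases eq_or_lt_of_le ht.1 with h0t | h0t
    · rw [← h0t, hper]
      exact hne hall ω ⟨hω, le_rfl⟩
    · exact hne hall t ⟨h0t, ht.2⟩
  · right
    intro t ht
    by_contra hcon
    have := hle t ht (not_lt.1 hcon) ω ⟨ht.2, le_rfl⟩
    linarith

/-- Two periodic solutions in `I` agree initially if a change of variable `G` turns the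
right-hand side into a strictly monotone function on `I`. -/
theorem periodic_initial_eq_of_strictMonoOn {ω : ℝ} (hω : 0 < ω) {f : ℝ → ℝ → ℝ} {G w : ℝ → ℝ}
    {I : Set ℝ} {σ : ℝ} (hσ : σ ≠ 0) (hG : ∀ u ∈ I, HasDerivAt G (w u) u)
    (hGm : StrictMonoOn G I)
    (hf : ∀ t ∈ Icc (0:ℝ) ω, StrictMonoOn (fun u => σ * (f u t * w u)) I) {x z : ℝ → ℝ}
    (hx : ∀ t ∈ Icc (0:ℝ) ω, HasDerivWithinAt x (f (x t) t) (Icc (0:ℝ) ω) t)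
    (hz : ∀ t ∈ Icc (0:ℝ) ω, HasDerivWithinAt z (f (z t) t) (Icc (0:ℝ) ω) t)
    (hxp : x 0 = x ω) (hzp : z 0 = z ω)
    (hxI : ∀ t ∈ Icc (0:ℝ) ω, x t ∈ I) (hzI : ∀ t ∈ Icc (0:ℝ) ω, z t ∈ I) : x 0 = z 0 := by
  wlog hlt : x 0 < z 0 generalizing x z
  · rcases lt_trichotomy (x 0) (z 0) with h | h | h
    · exact absurd h hlt
    · exact h
    · exact (this hz hx hzp hxp hzI hxI h).symm
  exfalso
  have h0 : (0:ℝ) ∈ Icc (0:ℝ) ω := ⟨le_rfl, hω.le⟩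
  have hD0 := hGm (hxI 0 h0) (hzI 0 h0) hlt
  have key := forall_lt_or_forall_gt_of_deriv_neg hω
    (h := fun t => -σ * (G (z t) - G (x t))) (c := -σ * (G (z 0) - G (x 0)))
    (h' := fun t => -σ * (w (z t) * f (z t) t - w (x t) * f (x t) t))
    (fun t ht => (((hG _ (hzI t ht)).comp_hasDerivWithinAt t (hz t ht)).sub
      ((hG _ (hxI t ht)).comp_hasDerivWithinAt t (hx t ht))).const_mul (-σ))
    (by simp only [hxp, hzp]) ?_
  · rcases key with h | h
    · exact lt_irrefl _ (h 0 h0)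
    · exact lt_irrefl _ (h 0 h0)
  · intro t ht heq
    have heq' := mul_left_cancel₀ (neg_ne_zero.2 hσ) heq
    have hxz : x t < z t := (hGm.lt_iff_lt (hxI t ht) (hzI t ht)).1 (by linarith)
    have := hf t ht (hxI t ht) (hzI t ht) hxz
    simp only at this
    linarith

/-- A polynomial of degree at most `n` with its constant, linear and leading terms singled out. -/
def splitPoly (n : ℕ) (c : ℕ → ℝ) (x : ℝ) : ℝ :=
  c 0 + c 1 * x + ∑ k ∈ Finset.Ico 2 n, c k * x ^ k + c n * x ^ n

/-- The first derivative of `splitPoly`. -/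
def splitPolyDeriv (n : ℕ) (c : ℕ → ℝ) (x : ℝ) : ℝ :=
  c 1 + ∑ k ∈ Finset.Ico 2 n, c k * (k * x ^ (k - 1)) + c n * (n * x ^ (n - 1))

/-- The second derivative of `splitPoly`. -/
def splitPolyDeriv₂ (n : ℕ) (c : ℕ → ℝ) (x : ℝ) : ℝ :=
  ∑ k ∈ Finset.Ico 2 n, c k * (k * ((k - 1 : ℕ) * x ^ (k - 1 - 1))) +
    c n * (n * ((n - 1 : ℕ) * x ^ (n - 1 - 1)))

theorem hasDerivAt_splitPoly (n : ℕ) (c : ℕ → ℝ) (x : ℝ) :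
    HasDerivAt (splitPoly n c) (splitPolyDeriv n c x) x := by
  have h1 : HasDerivAt (fun y => c 0 + c 1 * y) (c 1) x := by
    simpa using ((hasDerivAt_id' x).const_mul (c 1)).const_add (c 0)
  have h2 : HasDerivAt (fun y => ∑ k ∈ Finset.Ico 2 n, c k * y ^ k)
      (∑ k ∈ Finset.Ico 2 n, c k * (k * x ^ (k - 1))) x :=
    HasDerivAt.fun_sum fun k _ => (hasDerivAt_pow k x).const_mul (c k)
  exact (h1.add h2).add ((hasDerivAt_pow n x).const_mul (c n))

theorem hasDerivAt_splitPolyDeriv (n : ℕ) (c : ℕ → ℝ) (x : ℝ) :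
    HasDerivAt (splitPolyDeriv n c) (splitPolyDeriv₂ n c x) x := by
  have h2 : HasDerivAt (fun y => ∑ k ∈ Finset.Ico 2 n, c k * (k * y ^ (k - 1)))
      (∑ k ∈ Finset.Ico 2 n, c k * (k * ((k - 1 : ℕ) * x ^ (k - 1 - 1)))) x :=
    HasDerivAt.fun_sum fun k _ => ((hasDerivAt_pow (k - 1) x).const_mul _).const_mul (c k)
  exact (h2.const_add (c 1)).add (((hasDerivAt_pow (n - 1) x).const_mul _).const_mul (c n))

theorem splitPoly_const_mul (n : ℕ) (a : ℝ) (c : ℕ → ℝ) (x : ℝ) :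
    splitPoly n (fun k => a * c k) x = a * splitPoly n c x := by
  simp only [splitPoly, mul_add, Finset.mul_sum, mul_assoc]

theorem splitPoly_neg (n : ℕ) (c : ℕ → ℝ) (x : ℝ) :
    splitPoly n (fun k => -c k) x = -splitPoly n c x := by
  simpa using splitPoly_const_mul n (-1) c x

theorem splitPoly_comp_neg (n : ℕ) (c : ℕ → ℝ) (x : ℝ) :
    splitPoly n (fun k => (-1) ^ k * c k) x = splitPoly n c (-x) := by
  have h : ∀ k, (-1) ^ k * c k * x ^ k = c k * (-x) ^ k := fun k => by
    rw [neg_pow x]; ring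
  simp only [splitPoly, h]
  ring

theorem two_mul_pow_sub_nonneg (j : ℕ) {x R : ℝ} (hx : 0 ≤ x) (hxR : x ≤ R) :
    0 ≤ 2 * R ^ (j + 2) - (j + 2) * x ^ j * R ^ 2 + j * x ^ (j + 2) := by
  induction j with
  | zero => simp
  | succ j ih =>
    have h1 : x ^ (j + 1) ≤ R ^ (j + 1) := pow_le_pow_left₀ hx hxR _
    have hR : 0 ≤ R := hx.trans hxR
    have h2 : x ^ (j + 1) * (R + x) ≤ R ^ (j + 1) * (R + R) := by gcongr
    have h3 : 0 ≤ (R - x) * (R ^ (j + 1) * (R + R) - x ^ (j + 1) * (R + x)) :=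
      mul_nonneg (by linarith) (by linarith)
    have h4 := mul_nonneg hx ih
    push_cast
    calc (0:ℝ) ≤ _ := add_nonneg h3 h4
      _ = _ := by ring

theorem abs_pow_weight_le {k : ℕ} (hk : 2 ≤ k) {x R : ℝ} (hx : 0 ≤ x) (hxR : x ≤ R) :
    |k * x ^ (k - 1) * (R ^ 2 - x ^ 2) + 2 * x * x ^ k| ≤ 2 * x * R ^ k := by
  obtain ⟨j, rfl⟩ := Nat.exists_eq_add_of_le' hk
  have h0 := mul_nonneg hx (two_mul_pow_sub_nonneg j hx hxR)
  have hsq : x ^ 2 ≤ R ^ 2 := pow_le_pow_left₀ hx hxR 2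
  have h1 : (0:ℝ) ≤ ((j + 2 : ℕ) : ℝ) * x ^ (j + 2 - 1) * (R ^ 2 - x ^ 2) :=
    mul_nonneg (by positivity) (by linarith)
  rw [abs_of_nonneg (by positivity)]
  have e : j + 2 - 1 = j + 1 := rfl
  rw [e]
  push_cast
  rw [← sub_nonneg]
  calc (0:ℝ) ≤ _ := h0
    _ = _ := by ring

theorem splitPoly_weight_pos {n : ℕ} (hn : 2 ≤ n) {c : ℕ → ℝ} {R : ℝ}
    (hA : |c 0| + ∑ k ∈ Finset.Ico 2 n, |c k| * R ^ k + |c n| * R ^ n < c 1 * R) {x : ℝ}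
    (hx : 0 < x) (hxR : x < R) :
    0 < splitPolyDeriv n c x * (R ^ 2 - x ^ 2) + 2 * x * splitPoly n c x := by
  have hc1 : 0 < c 1 := by
    have h0 : 0 ≤ ∑ k ∈ Finset.Ico 2 n, |c k| * R ^ k :=
      Finset.sum_nonneg fun k _ => mul_nonneg (abs_nonneg _) (pow_nonneg (by linarith) _)
    have h1 : 0 ≤ |c n| * R ^ n := mul_nonneg (abs_nonneg _) (pow_nonneg (by linarith) _)
    have h2 := abs_nonneg (c 0)
    exact pos_of_mul_pos_left (by linarith : 0 < c 1 * R) (by linarith)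
  have hterm : ∀ k, 2 ≤ k → -(2 * x * (|c k| * R ^ k)) ≤
      c k * (k * x ^ (k - 1) * (R ^ 2 - x ^ 2) + 2 * x * x ^ k) := by
    intro k hk
    have h1 := mul_le_mul_of_nonneg_left (abs_pow_weight_le hk hx.le hxR.le) (abs_nonneg (c k))
    rw [← abs_mul] at h1
    linarith [neg_abs_le (c k * (k * x ^ (k - 1) * (R ^ 2 - x ^ 2) + 2 * x * x ^ k))]
  have hsum : -(2 * x * ∑ k ∈ Finset.Ico 2 n, |c k| * R ^ k) ≤
      ∑ k ∈ Finset.Ico 2 n, c k * (k * x ^ (k - 1) * (R ^ 2 - x ^ 2) + 2 * x * x ^ k) := by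
    rw [Finset.mul_sum, ← Finset.sum_neg_distrib]
    exact Finset.sum_le_sum fun k hk => hterm k (Finset.mem_Ico.1 hk).1
  have hdec : splitPolyDeriv n c x * (R ^ 2 - x ^ 2) + 2 * x * splitPoly n c x =
      2 * x * c 0 + c 1 * (R ^ 2 + x ^ 2) +
      ∑ k ∈ Finset.Ico 2 n, c k * (k * x ^ (k - 1) * (R ^ 2 - x ^ 2) + 2 * x * x ^ k) +
      c n * (n * x ^ (n - 1) * (R ^ 2 - x ^ 2) + 2 * x * x ^ n) := by
    have : ∑ k ∈ Finset.Ico 2 n, c k * (k * x ^ (k - 1) * (R ^ 2 - x ^ 2) + 2 * x * x ^ k) =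
        (∑ k ∈ Finset.Ico 2 n, c k * (k * x ^ (k - 1))) * (R ^ 2 - x ^ 2) +
        2 * x * ∑ k ∈ Finset.Ico 2 n, c k * x ^ k := by
      rw [Finset.sum_mul, Finset.mul_sum, ← Finset.sum_add_distrib]
      exact Finset.sum_congr rfl fun k _ => by ring
    rw [this, splitPoly, splitPolyDeriv]
    ring
  rw [hdec]
  have h5 := hterm n hn
  have h6 : 0 ≤ c 1 * (R - x) ^ 2 := by positivity
  have h7 : 2 * x * (|c 0| + ∑ k ∈ Finset.Ico 2 n, |c k| * R ^ k + |c n| * R ^ n)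
      < 2 * x * (c 1 * R) := by gcongr
  have h8 : -(2 * x * |c 0|) ≤ 2 * x * c 0 := by
    have := mul_le_mul_of_nonneg_left (neg_abs_le (c 0)) (by linarith : 0 ≤ 2 * x)
    linarith
  nlinarith

theorem splitPoly_div_strictMonoOn {n : ℕ} (hn : 2 ≤ n) {c : ℕ → ℝ} {R : ℝ}
    (hA : |c 0| + ∑ k ∈ Finset.Ico 2 n, |c k| * R ^ k + |c n| * R ^ n < c 1 * R) :
    StrictMonoOn (fun x => splitPoly n c x / (R ^ 2 - x ^ 2)) (Ioo 0 R) := by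
  have hne : ∀ x ∈ Ioo 0 R, R ^ 2 - x ^ 2 ≠ 0 := fun x hx => by
    have := pow_lt_pow_left₀ hx.2 hx.1.le two_ne_zero
    linarith
  have hd : ∀ x ∈ Ioo 0 R, HasDerivAt (fun x => splitPoly n c x / (R ^ 2 - x ^ 2)) _ x :=
    fun x hx => (hasDerivAt_splitPoly n c x).fun_div
      ((hasDerivAt_pow 2 x).const_sub (R ^ 2)) (hne x hx)
  refine strictMonoOn_of_deriv_pos (convex_Ioo 0 R)
    (fun x hx => (hd x hx).continuousAt.continuousWithinAt) fun x hx => ?_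
  rw [interior_Ioo] at hx
  rw [(hd x hx).deriv]
  refine div_pos ?_ (by have := hne x hx; positivity)
  refine (splitPoly_weight_pos hn hA hx.1 hx.2).trans_eq ?_
  rw [Nat.add_one_sub_one, pow_one]
  push_cast
  ring

theorem splitPoly_pos {n : ℕ} {c : ℕ → ℝ} {R : ℝ} (hR : 0 < R)
    (hA : |c 0| + ∑ k ∈ Finset.Ico 2 n, |c k| * R ^ k + |c n| * R ^ n < c 1 * R) :
    0 < splitPoly n c R := by
  have hs : -∑ k ∈ Finset.Ico 2 n, |c k| * R ^ k ≤ ∑ k ∈ Finset.Ico 2 n, c k * R ^ k := by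
    rw [← Finset.sum_neg_distrib]
    refine Finset.sum_le_sum fun k _ => ?_
    rw [← neg_mul]
    exact mul_le_mul_of_nonneg_right (neg_abs_le _) (by positivity)
  have hl : -(|c n| * R ^ n) ≤ c n * R ^ n := by
    rw [← neg_mul]
    exact mul_le_mul_of_nonneg_right (neg_abs_le _) (by positivity)
  rw [splitPoly]
  linarith [neg_abs_le (c 0)]

theorem splitPolyDeriv₂_nonneg {n : ℕ} (hn : 2 ≤ n) {c : ℕ → ℝ} {R : ℝ} (hR : 0 < R)
    (hB : ∑ k ∈ Finset.Ico 2 n, ((k:ℝ) - 1) * (|c k| * R ^ k) < n * (c n * R ^ n)) {x : ℝ}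
    (hx : R ≤ x) : 0 ≤ splitPolyDeriv₂ n c x := by
  have hx0 : 0 < x := hR.trans_le hx
  have hn1 : (1:ℝ) ≤ n := by exact_mod_cast (by omega : 1 ≤ n)
  have hcast : ∀ k : ℕ, 2 ≤ k → ((k - 1 : ℕ) : ℝ) = k - 1 := fun k hk => by
    rw [Nat.cast_sub (by omega)]; simp
  have hterm : ∀ k ∈ Finset.Ico 2 n,
      -(((k:ℝ) - 1) * (|c k| * R ^ k) * ((n - 1) * (x ^ (n - 2) / R ^ n))) ≤
      c k * (k * ((k - 1 : ℕ) * x ^ (k - 1 - 1))) := by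
    intro k hk
    obtain ⟨hk2, hkn⟩ := Finset.mem_Ico.1 hk
    have hk1 : (1:ℝ) ≤ k := by exact_mod_cast (by omega : 1 ≤ k)
    have hkn' : (k:ℝ) ≤ n - 1 := by
      have : ((k + 1 : ℕ) : ℝ) ≤ n := by exact_mod_cast hkn
      push_cast at this
      linarith
    have hpow : R ^ k * (x ^ (n - 2) / R ^ n) ≥ x ^ (k - 2) := by
      have e1 : x ^ (n - 2) = x ^ (k - 2) * x ^ (n - k) := by
        rw [← pow_add]; congr 1; omega
      have e2 : R ^ n = R ^ k * R ^ (n - k) := by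
        rw [← pow_add]; congr 1; omega
      have h := pow_le_pow_left₀ hR.le hx (n - k)
      rw [e1, e2, mul_div_assoc', ge_iff_le, le_div_iff₀ (by positivity)]
      have : 0 ≤ x ^ (k - 2) * R ^ k := by positivity
      nlinarith
    rw [hcast k hk2, Nat.sub_sub]
    have h1 : |c k| * (k * (((k:ℝ) - 1) * x ^ (k - 2))) ≤
        |c k| * ((n - 1) * (((k:ℝ) - 1) * (R ^ k * (x ^ (n - 2) / R ^ n)))) := by
      have : (0:ℝ) ≤ k - 1 := by linarith
      gcongr
    have h2 : -(|c k| * (k * (((k:ℝ) - 1) * x ^ (k - 2)))) ≤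
        c k * (k * (((k:ℝ) - 1) * x ^ (k - 2))) := by
      rw [← neg_mul]
      have : (0:ℝ) ≤ k - 1 := by linarith
      exact mul_le_mul_of_nonneg_right (neg_abs_le _) (by positivity)
    linarith
  have hsum := Finset.sum_le_sum hterm
  rw [Finset.sum_neg_distrib, ← Finset.sum_mul] at hsum
  have hw : 0 ≤ ((n:ℝ) - 1) * (x ^ (n - 2) / R ^ n) :=
    mul_nonneg (by linarith) (by positivity)
  have h3 := mul_le_mul_of_nonneg_right hB.le hw
  have h4 : (n:ℝ) * (c n * R ^ n) * ((n - 1) * (x ^ (n - 2) / R ^ n)) =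
      c n * (n * ((n - 1 : ℕ) * x ^ (n - 1 - 1))) := by
    rw [hcast n hn, Nat.sub_sub]
    field_simp
  rw [splitPolyDeriv₂]
  linarith

theorem splitPoly_pos_of_le {n : ℕ} (hn : 2 ≤ n) {c : ℕ → ℝ} {R : ℝ} (hR : 0 < R)
    (hA : |c 0| + ∑ k ∈ Finset.Ico 2 n, |c k| * R ^ k + |c n| * R ^ n < c 1 * R)
    (hB : ∑ k ∈ Finset.Ico 2 n, ((k:ℝ) - 1) * (|c k| * R ^ k) < n * (c n * R ^ n)) {x : ℝ}
    (hx : R ≤ x) : 0 < splitPoly n c x := by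
  have hd0 : 0 < splitPolyDeriv n c R := by
    refine pos_of_mul_pos_left (b := R) ?_ hR.le
    have hpow : ∀ k, 2 ≤ k → R ^ (k - 1) * R = R ^ k := fun k hk => by
      rw [← pow_succ]; congr 1; omega
    have h1 : -∑ k ∈ Finset.Ico 2 n, (k:ℝ) * (|c k| * R ^ k) ≤
        ∑ k ∈ Finset.Ico 2 n, c k * (k * (R ^ (k - 1) * R)) := by
      rw [← Finset.sum_neg_distrib]
      refine Finset.sum_le_sum fun k hk => ?_
      rw [hpow k (Finset.mem_Ico.1 hk).1]
      have := mul_le_mul_of_nonneg_right (neg_abs_le (c k))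
        (by positivity : (0:ℝ) ≤ k * R ^ k)
      linarith
    have h2 : ∑ k ∈ Finset.Ico 2 n, ((k:ℝ) - 1) * (|c k| * R ^ k) =
        ∑ k ∈ Finset.Ico 2 n, (k:ℝ) * (|c k| * R ^ k) -
          ∑ k ∈ Finset.Ico 2 n, |c k| * R ^ k := by
      rw [← Finset.sum_sub_distrib]
      exact Finset.sum_congr rfl fun k _ => by ring
    have h3 : splitPolyDeriv n c R * R = c 1 * R +
        ∑ k ∈ Finset.Ico 2 n, c k * (k * (R ^ (k - 1) * R)) + n * (c n * R ^ n) := by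
      rw [splitPolyDeriv, ← hpow n hn, add_mul, add_mul, Finset.sum_mul]
      congr 1
      · congr 1
        exact Finset.sum_congr rfl fun k _ => by ring
      · ring
    have h4 : 0 ≤ |c n| * R ^ n := by positivity
    linarith [abs_nonneg (c 0)]
  have hm1 : MonotoneOn (splitPolyDeriv n c) (Ici R) := by
    refine monotoneOn_of_deriv_nonneg (convex_Ici R)
      (fun y _ => (hasDerivAt_splitPolyDeriv n c y).continuousAt.continuousWithinAt)
      (fun y _ => (hasDerivAt_splitPolyDeriv n c y).differentiableAt.differentiableWithinAt)
      fun y hy => ?_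
    rw [interior_Ici] at hy
    rw [(hasDerivAt_splitPolyDeriv n c y).deriv]
    exact splitPolyDeriv₂_nonneg hn hR hB (mem_Ioi.1 hy).le
  have hm0 : MonotoneOn (splitPoly n c) (Ici R) := by
    refine monotoneOn_of_deriv_nonneg (convex_Ici R)
      (fun y _ => (hasDerivAt_splitPoly n c y).continuousAt.continuousWithinAt)
      (fun y _ => (hasDerivAt_splitPoly n c y).differentiableAt.differentiableWithinAt)
      fun y hy => ?_
    rw [interior_Ici] at hy
    rw [(hasDerivAt_splitPoly n c y).deriv]
    exact hd0.le.trans (hm1 self_mem_Ici (mem_Ioi.1 hy).le (mem_Ioi.1 hy).le)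
  exact (splitPoly_pos hR hA).trans_le (hm0 self_mem_Ici hx hx)

theorem splitPoly_div_sub_strictMonoOn {n : ℕ} (hn : 2 ≤ n) {c : ℕ → ℝ} {R : ℝ} (hR : 0 < R)
    (hneg : splitPoly n c R < 0)
    (hB : ∑ k ∈ Finset.Ico 2 n, ((k:ℝ) - 1) * (|c k| * R ^ k) < n * (c n * R ^ n)) :
    StrictMonoOn (fun x => splitPoly n c x / (x - R)) (Ioi R) := by
  have hN : ∀ x, HasDerivAt (fun y => splitPolyDeriv n c y * (y - R) - splitPoly n c y)
      (splitPolyDeriv₂ n c x * (x - R)) x := fun x => by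
    refine (((hasDerivAt_splitPolyDeriv n c x).fun_mul
      ((hasDerivAt_id' x).sub_const R)).fun_sub (hasDerivAt_splitPoly n c x)).congr_deriv ?_
    ring
  have hNm : MonotoneOn (fun y => splitPolyDeriv n c y * (y - R) - splitPoly n c y) (Ici R) := by
    refine monotoneOn_of_deriv_nonneg (convex_Ici R)
      (fun y _ => (hN y).continuousAt.continuousWithinAt)
      (fun y _ => (hN y).differentiableAt.differentiableWithinAt) fun y hy => ?_
    rw [interior_Ici] at hy
    rw [(hN y).deriv]
    exact mul_nonneg (splitPolyDeriv₂_nonneg hn hR hB (mem_Ioi.1 hy).le)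
      (sub_nonneg.2 (mem_Ioi.1 hy).le)
  have hne : ∀ x ∈ Ioi R, x - R ≠ 0 := fun x hx => (sub_pos.2 hx).ne'
  have hd : ∀ x ∈ Ioi R, HasDerivAt (fun x => splitPoly n c x / (x - R)) _ x :=
    fun x hx => (hasDerivAt_splitPoly n c x).fun_div ((hasDerivAt_id' x).sub_const R) (hne x hx)
  refine strictMonoOn_of_deriv_pos (convex_Ioi R)
    (fun x hx => (hd x hx).continuousAt.continuousWithinAt) fun x hx => ?_
  rw [interior_Ioi] at hx
  rw [(hd x hx).deriv]
  refine div_pos ?_ (by have := hne x hx; positivity)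
  have := hNm self_mem_Ici (mem_Ioi.1 hx).le (mem_Ioi.1 hx).le
  simp only [sub_self, mul_zero, zero_sub, mul_one] at this ⊢
  linarith

theorem exists_card_le_two_of_subsingleton {α : Type*} {A B : Set α} (hA : A.Subsingleton)
    (hB : B.Subsingleton) : ∃ S : Finset α, S.card ≤ 2 ∧ A ∪ B ⊆ S := by
  classical
  have key : ∀ {A : Set α}, A.Subsingleton → ∃ S : Finset α, S.card ≤ 1 ∧ A ⊆ S := by
    intro A hA
    rcases hA.eq_empty_or_singleton with h | ⟨a, h⟩
    · exact ⟨∅, by simp, by simp [h]⟩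
    · exact ⟨{a}, by simp, by simp [h]⟩
  obtain ⟨S, hS, hAS⟩ := key hA
  obtain ⟨T, hT, hBT⟩ := key hB
  refine ⟨S ∪ T, (Finset.card_union_le S T).trans (by omega), ?_⟩
  rw [Finset.coe_union]
  exact union_subset_union hAS hBT

theorem exists_card_le_two_positive {n : ℕ} (hn : 2 ≤ n) {ω : ℝ} (hω : 0 < ω) {σ : ℝ}
    (hσ : σ = 1 ∨ σ = -1) {c : ℝ → ℕ → ℝ} {R : ℝ} (hR : 0 < R)
    (hc : (∀ t, c t n = 1) ∨ (∀ t, c t n = -1))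
    (hA : ∀ t ∈ Icc (0:ℝ) ω, |c t 0| + ∑ k ∈ Finset.Ico 2 n, |c t k| * R ^ k + |c t n| * R ^ n
      < c t 1 * R)
    (hB : ∀ t ∈ Icc (0:ℝ) ω,
      ∑ k ∈ Finset.Ico 2 n, ((k:ℝ) - 1) * (|c t k| * R ^ k) < n * R ^ n) :
    ∃ S : Finset ℝ, S.card ≤ 2 ∧ ∀ x : ℝ → ℝ,
      (∀ t ∈ Icc (0:ℝ) ω,
        HasDerivWithinAt x (σ * splitPoly n (c t) (x t)) (Icc (0:ℝ) ω) t) → x 0 = x ω →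
      (∀ t ∈ Icc (0:ℝ) ω, 0 < x t) → x 0 ∈ S := by
  have h0 : (0:ℝ) ∈ Icc (0:ℝ) ω := ⟨le_rfl, hω.le⟩
  have hσ0 : σ ≠ 0 := by rcases hσ with rfl | rfl <;> norm_num
  have hσσ : σ * σ = 1 := by rcases hσ with rfl | rfl <;> norm_num
  let sols (I : Set ℝ) : Set ℝ := {a | ∃ x : ℝ → ℝ,
    (∀ t ∈ Icc (0:ℝ) ω, HasDerivWithinAt x (σ * splitPoly n (c t) (x t)) (Icc (0:ℝ) ω) t) ∧
    x 0 = x ω ∧ (∀ t ∈ Icc (0:ℝ) ω, x t ∈ I) ∧ x 0 = a}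
  have hin : (sols (Ioo 0 R)).Subsingleton := by
    rintro _ ⟨x, hx, hxp, hxI, rfl⟩ _ ⟨z, hz, hzp, hzI, rfl⟩
    have hG : ∀ u ∈ Ioo 0 R, HasDerivAt (fun u => log (R + u) - log (R - u))
        (2 * R / (R ^ 2 - u ^ 2)) u := by
      intro u hu
      have h1 : R + u ≠ 0 := by linarith [hu.1]
      have h2 : R - u ≠ 0 := by linarith [hu.2]
      refine ((((hasDerivAt_id' u).const_add R).log h1).fun_sub
        (((hasDerivAt_id' u).const_sub R).log h2)).congr_deriv ?_
      have h3 : R ^ 2 - u ^ 2 ≠ 0 := by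
        rw [sq_sub_sq]; exact mul_ne_zero h1 h2
      field_simp
      ring
    refine periodic_initial_eq_of_strictMonoOn hω hσ0 (f := fun u t => σ * splitPoly n (c t) u)
      hG ?_ ?_ hx hz hxp hzp hxI hzI
    · intro u hu v hv huv
      have h1 := Real.log_lt_log (by linarith [hu.1] : 0 < R + u) (by linarith : R + u < R + v)
      have h2 := Real.log_lt_log (by linarith [hv.2] : 0 < R - v) (by linarith : R - v < R - u)
      simp only
      linarith
    · intro t ht u hu v hv huv
      have := splitPoly_div_strictMonoOn hn (hA t ht) hu hv huv
      have h2 := mul_lt_mul_of_pos_left this (by linarith : 0 < 2 * R)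
      simp only
      calc _ = σ * σ * (2 * R * (splitPoly n (c t) u / (R ^ 2 - u ^ 2))) := by ring
        _ < σ * σ * (2 * R * (splitPoly n (c t) v / (R ^ 2 - v ^ 2))) := by
          rw [hσσ, one_mul, one_mul]; exact h2
        _ = _ := by ring
  have hout : (sols (Ioi R)).Subsingleton := by
    rintro _ ⟨x, hx, hxp, hxI, rfl⟩ _ ⟨z, hz, hzp, hzI, rfl⟩
    rcases hc with hc | hc
    · exfalso
      have := forall_lt_or_forall_gt_of_deriv_neg hω (c := -σ * x 0)
        (fun t ht => (hx t ht).const_mul (-σ)) (by rw [hxp]) (fun t ht _ => by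
          have := splitPoly_pos_of_le hn hR (hA t ht)
            (by rw [hc t, one_mul]; exact hB t ht) (le_of_lt (hxI t ht))
          rw [← mul_assoc, neg_mul, hσσ]
          linarith)
      rcases this with h | h
      · exact lt_irrefl _ (h 0 h0)
      · exact lt_irrefl _ (h 0 h0)
    · have hG : ∀ u ∈ Ioi R, HasDerivAt (fun u => log (u - R)) (1 / (u - R)) u :=
        fun u hu => ((hasDerivAt_id' u).sub_const R).log (sub_pos.2 hu).ne'
      refine periodic_initial_eq_of_strictMonoOn hω (neg_ne_zero.2 hσ0)
        (f := fun u t => σ * splitPoly n (c t) u) hG ?_ ?_ hx hz hxp hzp hxI hzI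
      · intro u hu v hv huv
        exact Real.log_lt_log (sub_pos.2 hu) (by linarith)
      · intro t ht u hu v hv huv
        have := splitPoly_div_sub_strictMonoOn hn (c := fun k => -c t k) hR
          (by rw [splitPoly_neg]; linarith [splitPoly_pos hR (hA t ht)])
          (by simp only [hc t, neg_neg, one_mul, abs_neg]; exact hB t ht) hu hv huv
        simp only [splitPoly_neg] at this
        simp only
        calc _ = σ * σ * (-splitPoly n (c t) u / (u - R)) := by ring
          _ < σ * σ * (-splitPoly n (c t) v / (v - R)) := by
            rw [hσσ, one_mul, one_mul]; exact this
          _ = _ := by ring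
  obtain ⟨S, hS, hsub⟩ := exists_card_le_two_of_subsingleton hin hout
  refine ⟨S, hS, fun x hx hxp hpos => hsub ?_⟩
  have hsides : (∀ t ∈ Icc (0:ℝ) ω, x t < R) ∨ (∀ t ∈ Icc (0:ℝ) ω, R < x t) := by
    have := forall_lt_or_forall_gt_of_deriv_neg hω (c := -σ * R)
      (fun t ht => (hx t ht).const_mul (-σ)) (by rw [hxp]) (fun t ht heq => by
        rw [mul_left_cancel₀ (neg_ne_zero.2 hσ0) heq, ← mul_assoc, neg_mul, hσσ]
        linarith [splitPoly_pos hR (hA t ht)])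
    rcases hσ with rfl | rfl
    · exact this.symm.imp (fun h t ht => by linarith [h t ht]) fun h t ht => by linarith [h t ht]
    · exact this.imp (fun h t ht => by linarith [h t ht]) fun h t ht => by linarith [h t ht]
  rcases hsides with h | h
  · exact Or.inl ⟨x, hx, hxp, fun t ht => ⟨hpos t ht, h t ht⟩, rfl⟩
  · exact Or.inr ⟨x, hx, hxp, h, rfl⟩

theorem sub_one_mul_pow_mono {n : ℕ} {j k : ℕ} (hj : 1 ≤ j) (hjk : j ≤ k) (hkn : k ≤ n) :
    ((j:ℝ) - 1) * (1 - 1 / (n:ℝ)) ^ j ≤ ((k:ℝ) - 1) * (1 - 1 / (n:ℝ)) ^ k := by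
  induction k, hjk using Nat.le_induction with
  | base => exact le_rfl
  | succ k hk ih =>
    refine (ih (by omega)).trans ?_
    have hn0 : (0:ℝ) < n := by exact_mod_cast (by omega : 0 < n)
    have hkn' : (k:ℝ) / n ≤ 1 := by
      rw [div_le_one hn0]
      exact_mod_cast (by omega : k ≤ n)
    have hρ : 0 ≤ 1 - 1 / (n:ℝ) := by
      rw [sub_nonneg, div_le_one hn0]
      exact_mod_cast (by omega : 1 ≤ n)
    have h := mul_le_mul_of_nonneg_right
      (by rw [mul_sub, mul_one, mul_one_div]; linarith : (k:ℝ) - 1 ≤ k * (1 - 1 / (n:ℝ)))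
      (pow_nonneg hρ k)
    push_cast
    rw [pow_succ]
    linarith

theorem two_div_le_one_sub_inv_pow {n : ℕ} (hn : 5 ≤ n) :
    2 / (n:ℝ) ≤ (1 - 1 / (n:ℝ)) ^ (n - 1) := by
  have h := sub_one_mul_pow_mono (n := n) (j := 4) (k := n - 1) (by norm_num) (by omega)
    (by omega)
  obtain ⟨a, rfl⟩ := Nat.exists_eq_add_of_le' hn
  rw [Nat.cast_sub (by omega)] at h
  push_cast at h ⊢
  have ha : (0:ℝ) ≤ a := a.cast_nonneg
  have hρ : 1 - 1 / ((a:ℝ) + 5) = (a + 4) / (a + 5) := by field_simp; ring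
  rw [hρ] at h ⊢
  have hpoly : 2 * ((a:ℝ) + 3) * (a + 5) ^ 3 ≤ 3 * (a + 4) ^ 4 := by
    rw [← sub_nonneg]
    have : 3 * ((a:ℝ) + 4) ^ 4 - 2 * (a + 3) * (a + 5) ^ 3 =
      a ^ 4 + 12 * a ^ 3 + 48 * a ^ 2 + 68 * a + 18 := by ring
    rw [this]
    positivity
  have h4 : 2 / ((a:ℝ) + 5) * (a + 3) ≤ 3 * ((a + 4) / (a + 5)) ^ 4 := by
    rw [div_pow, div_mul_eq_mul_div, mul_div_assoc',
      div_le_div_iff₀ (by positivity) (by positivity)]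
    have := mul_le_mul_of_nonneg_right hpoly (by positivity : 0 ≤ (a:ℝ) + 5)
    linarith
  refine le_of_mul_le_mul_right ?_ (by positivity : 0 < (a:ℝ) + 3)
  linarith

theorem sum_one_sub_inv_pow_le {n : ℕ} (hn : 5 ≤ n) :
    ∑ k ∈ Finset.Ico 2 n, (1 - 1 / (n:ℝ)) ^ k ≤ (1 - 1 / (n:ℝ)) * (n - 3) := by
  have hn0 : (0:ℝ) < n := by exact_mod_cast (by omega : 0 < n)
  have hρ : 0 ≤ 1 - 1 / (n:ℝ) := by
    rw [sub_nonneg, div_le_one hn0]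
    exact_mod_cast (by omega : 1 ≤ n)
  have h := geom_sum_Ico_mul (1 - 1 / (n:ℝ)) (show 2 ≤ n by omega)
  have h2 := mul_le_mul_of_nonneg_left (two_div_le_one_sub_inv_pow hn) hρ
  rw [← pow_succ', show n - 1 + 1 = n by omega] at h2
  have e : ∑ k ∈ Finset.Ico 2 n, (1 - 1 / (n:ℝ)) ^ k =
      n * ((1 - 1 / (n:ℝ)) ^ 2 - (1 - 1 / (n:ℝ)) ^ n) := by
    rw [← neg_sub ((1 - 1 / (n:ℝ)) ^ n), ← h]
    field_simp
    ring
  rw [e]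
  have h3 := mul_le_mul_of_nonneg_left h2 hn0.le
  have e2 : (n:ℝ) * (1 - 1 / (n:ℝ)) ^ 2 - n * ((1 - 1 / (n:ℝ)) * (2 / n)) =
      (1 - 1 / (n:ℝ)) * (n - 3) := by
    field_simp
    ring
  linarith

theorem one_sub_inv_pow_le {n : ℕ} (hn : 5 ≤ n) : (1 - 1 / (n:ℝ)) ^ n ≤ 1 - 2 / (n:ℝ) := by
  obtain ⟨a, rfl⟩ := Nat.exists_eq_add_of_le' hn
  have h := one_add_mul_le_pow (a := 1 / ((a:ℝ) + 4))
    (le_trans (by norm_num) (by positivity : (0:ℝ) ≤ 1 / ((a:ℝ) + 4))) (a + 5)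
  push_cast at h ⊢
  have e1 : 1 - 1 / ((a:ℝ) + 5) = ((1:ℝ) + 1 / ((a:ℝ) + 4))⁻¹ := by field_simp; ring
  rw [e1, inv_pow]
  refine (inv_anti₀ (by positivity) h).trans ?_
  rw [← sub_nonneg]
  have e2 : 1 - 2 / ((a:ℝ) + 5) - ((1:ℝ) + ((a:ℝ) + 5) * (1 / ((a:ℝ) + 4)))⁻¹ =
      (a ^ 2 + 6 * a + 7) / ((a + 5) * (2 * a + 9)) := by
    field_simp
    ring
  rw [e2]
  positivity

theorem sin_pi_div_mul_sq_lt {n : ℕ} (hn : 5 ≤ n) :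
    sin (π / ((n:ℝ) - 2)) * ((n:ℝ) - 2) ^ 2 < ((n:ℝ) - 1) * (n - 3) := by
  rcases hn.eq_or_lt with rfl | hn
  · norm_num [Real.sin_pi_div_three]
    nlinarith [Real.sq_sqrt (show (0:ℝ) ≤ 3 by norm_num), Real.sqrt_nonneg 3]
  · have h6 : (6:ℝ) ≤ n := by exact_mod_cast hn
    have hm : 0 < (n:ℝ) - 2 := by linarith
    have hs := Real.sin_lt (div_pos Real.pi_pos hm)
    have h2 := mul_lt_mul_of_pos_right hs (by positivity : 0 < ((n:ℝ) - 2) ^ 2)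
    have e : π / ((n:ℝ) - 2) * ((n:ℝ) - 2) ^ 2 = π * (n - 2) := by field_simp
    nlinarith [Real.pi_lt_d2]

theorem sin_pi_div_nonneg {n : ℕ} (hn : 5 ≤ n) : 0 ≤ sin (π / ((n:ℝ) - 2)) := by
  have h5 : (5:ℝ) ≤ n := by exact_mod_cast hn
  exact Real.sin_nonneg_of_nonneg_of_le_pi
    (div_nonneg Real.pi_pos.le (by linarith)) (div_le_self Real.pi_pos.le (by linarith))

/-- The coefficient bounds, rescaled to the radius `(1 - 1 / n) * K ^ (1 / n)`. -/
theorem coeff_bounds {n : ℕ} (hn : 5 ≤ n) {K : ℝ} {a : ℕ → ℝ} (hK : |a 0| < K)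
    (ha : ∀ k ∈ Finset.Ico 2 n, |a k| ≤ (K - |a 0|) * sin (π / ((n:ℝ) - 2)) /
        (((n:ℝ) - 3) * K ^ ((k:ℝ) / (n:ℝ))))
    (hb : (K + |a 0| + |a (n - 1)| + (K - |a 0|) * sin (π / ((n:ℝ) - 2)))
        / K ^ ((1:ℝ) / (n:ℝ)) ≤ |a 1|) :
    |a 0| + ∑ k ∈ Finset.Ico 2 n, |a k| * ((1 - 1 / (n:ℝ)) * K ^ ((1:ℝ) / (n:ℝ))) ^ k +
      ((1 - 1 / (n:ℝ)) * K ^ ((1:ℝ) / (n:ℝ))) ^ n <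
        |a 1| * ((1 - 1 / (n:ℝ)) * K ^ ((1:ℝ) / (n:ℝ))) ∧
    ∑ k ∈ Finset.Ico 2 n,
      ((k:ℝ) - 1) * (|a k| * ((1 - 1 / (n:ℝ)) * K ^ ((1:ℝ) / (n:ℝ))) ^ k) <
        n * ((1 - 1 / (n:ℝ)) * K ^ ((1:ℝ) / (n:ℝ))) ^ n := by
  have hK0 : 0 < K := (abs_nonneg _).trans_lt hK
  have h5 : (5:ℝ) ≤ n := by exact_mod_cast hn
  have hn0 : (0:ℝ) < n := by linarith
  have hn3 : (0:ℝ) < n - 3 := by linarith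
  have hinv : 0 < 1 / (n:ℝ) := by positivity
  have hinv1 : 1 / (n:ℝ) ≤ 1 / 5 := one_div_le_one_div_of_le (by norm_num) h5
  have hpow : ∀ k : ℕ, K ^ ((k:ℝ) / (n:ℝ)) = (K ^ ((1:ℝ) / (n:ℝ))) ^ k := fun k => by
    rw [← Real.rpow_natCast, ← Real.rpow_mul hK0.le]
    congr 1
    ring
  have hrn : (K ^ ((1:ℝ) / (n:ℝ))) ^ n = K := by
    rw [← hpow, div_self hn0.ne', Real.rpow_one]
  simp only [hpow] at ha
  have hr : 0 < K ^ ((1:ℝ) / (n:ℝ)) := Real.rpow_pos_of_pos hK0 _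
  have hsum := sum_one_sub_inv_pow_le hn
  have hpn := one_sub_inv_pow_le hn
  have hmono := fun k => sub_one_mul_pow_mono (n := n) (j := k) (k := n - 1)
  rw [Nat.cast_sub (by omega : 1 ≤ n), Nat.cast_one] at hmono
  have hsin := sin_pi_div_mul_sq_lt hn
  have hs0 := sin_pi_div_nonneg hn
  have hqn : |a (n - 1)| ≥ 0 := abs_nonneg _
  generalize K ^ ((1:ℝ) / (n:ℝ)) = r at *
  generalize sin (π / ((n:ℝ) - 2)) = s at *
  generalize |a (n - 1)| = q at *
  have hρn : (n:ℝ) * (1 - 1 / (n:ℝ)) = n - 1 := by field_simp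
  have hρ2 : 1 - 2 / (n:ℝ) = 2 * (1 - 1 / (n:ℝ)) - 1 := by ring
  rw [hρ2] at hpn
  have hρ : 0 < 1 - 1 / (n:ℝ) := by linarith
  have hρ1 : 1 - 1 / (n:ℝ) < 1 := by linarith
  generalize 1 - 1 / (n:ℝ) = ρ at *
  have hp := abs_nonneg (a 0)
  generalize |a 0| = p at *
  have hw : 0 ≤ (K - p) * s / (n - 3) :=
    div_nonneg (mul_nonneg (by linarith) hs0) hn3.le
  have hak : ∀ k ∈ Finset.Ico 2 n, |a k| * (ρ * r) ^ k ≤ (K - p) * s / (n - 3) * ρ ^ k := by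
    intro k hk
    have h := mul_le_mul_of_nonneg_right (ha k hk) (by positivity : 0 ≤ (ρ * r) ^ k)
    refine h.trans_eq ?_
    rw [mul_pow]
    field_simp
  constructor
  · have h1 := (Finset.sum_le_sum hak).trans_eq (Finset.mul_sum _ _ _).symm
    have h2 := mul_le_mul_of_nonneg_left hsum hw
    have e2 : (K - p) * s / (n - 3) * (ρ * (n - 3)) = ρ * ((K - p) * s) := by field_simp
    have h3 : ρ * (K + p + q + (K - p) * s) ≤ |a 1| * (ρ * r) := by
      have := mul_le_mul_of_nonneg_left ((div_le_iff₀ hr).1 hb) hρ.le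
      linarith
    have h4 : (ρ * r) ^ n ≤ (2 * ρ - 1) * K := by
      rw [mul_pow, hrn]
      exact mul_le_mul_of_nonneg_right hpn hK0.le
    have h5 : (1 - ρ) * p < (1 - ρ) * K := mul_lt_mul_of_pos_left hK (by linarith)
    have h6 : 0 ≤ ρ * q := by positivity
    linarith
  · have hterm : ∀ k ∈ Finset.Ico 2 n, ((k:ℝ) - 1) * (|a k| * (ρ * r) ^ k) ≤
        (K - p) * s / (n - 3) * ((n - 1 - 1) * ρ ^ (n - 1)) := by
      intro k hk
      obtain ⟨hk2, hkn⟩ := Finset.mem_Ico.1 hk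
      have hk1 : (0:ℝ) ≤ k - 1 := by
        rw [sub_nonneg]; exact_mod_cast (by omega : 1 ≤ k)
      have h1 := mul_le_mul_of_nonneg_left (hak k hk) hk1
      have h2 := mul_le_mul_of_nonneg_left (hmono k (by omega) (by omega) (by omega)) hw
      linarith
    have h1 := Finset.sum_le_sum hterm
    rw [Finset.sum_const, Nat.card_Ico, nsmul_eq_mul, Nat.cast_sub (by omega : 2 ≤ n),
      Nat.cast_ofNat] at h1
    refine h1.trans_lt ?_
    have hpos : 0 < ρ ^ (n - 1) := by positivity
    have e : (n:ℝ) * (ρ * r) ^ n = (n - 1) * K * ρ ^ (n - 1) := by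
      rw [mul_pow, hrn, ← hρn]
      conv_lhs => rw [show n = n - 1 + 1 by omega, pow_succ]
      rw [Nat.cast_add, Nat.cast_one, Nat.cast_sub (by omega : 1 ≤ n)]
      push_cast
      ring
    rw [e]
    have h2 : (K - p) * (s * (n - 2) ^ 2) < K * ((n - 1) * (n - 3)) := by
      have h3 := mul_lt_mul_of_pos_left hsin (by linarith : 0 < K - p)
      have h4 : 0 ≤ p * (((n:ℝ) - 1) * (n - 3)) :=
        mul_nonneg hp (mul_nonneg (by linarith) hn3.le)
      linarith
    have h3 := mul_lt_mul_of_pos_right ((div_lt_iff₀ hn3).2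
      (by linarith : (K - p) * (s * (n - 2) ^ 2) < K * (n - 1) * (n - 3))) hpos
    refine (Eq.trans_lt ?_ h3).trans_eq (by ring)
    ring

theorem fR_eq_splitPoly {n : ℕ} (hn : 2 ≤ n) (P : Fin n → ℝ → ℝ) (x t : ℝ) :
    fR n P x t = splitPoly n (fun k => if h : k < n then P ⟨k, h⟩ t else 1) x := by
  have h := Finset.sum_range
    (n := n) (fun k => (if h : k < n then P ⟨k, h⟩ t else 1) * x ^ k)
  simp only [Fin.is_lt, dite_true, Fin.eta] at h
  rw [fR, ← h, ← Finset.sum_range_add_sum_Ico _ hn, splitPoly, Finset.sum_range_succ,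
    Finset.sum_range_one]
  simp only [lt_irrefl, dite_false]
  ring

theorem exists_sign_mul_eq_abs {f : ℝ → ℝ} {s : Set ℝ} (hs : IsPreconnected s)
    (hf : ContinuousOn f s) (hne : ∀ t ∈ s, f t ≠ 0) :
    ∃ σ : ℝ, (σ = 1 ∨ σ = -1) ∧ ∀ t ∈ s, σ * f t = |f t| := by
  by_cases h : ∀ t ∈ s, 0 < f t
  · exact ⟨1, Or.inl rfl, fun t ht => by rw [one_mul, abs_of_pos (h t ht)]⟩
  · push Not at h
    obtain ⟨a, has, ha⟩ := h
    refine ⟨-1, Or.inr rfl, fun t ht => ?_⟩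
    have : f t ≤ 0 := by
      by_contra! hpos
      obtain ⟨u, hu, hu0⟩ := hs.intermediate_value has ht hf ⟨ha, hpos.le⟩
      exact hne u hu hu0
    rw [abs_of_nonpos this, neg_one_mul]

/-- Theorem 1.1 (real part): under the stated bounds (now for every `i ≠ 0, 1`,
including `i = n-1`), equation (1.1) has at most two positive and at most two
negative real periodic solutions. -/
theorem theorem_1_1_real_count
    {n : ℕ} (hn : 5 ≤ n) {ω : ℝ} (hω : 0 < ω)
    (P : Fin n → ℝ → ℝ) (hP : ∀ i, ContinuousOn (P i) (Icc 0 ω))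
    (K : ℝ) (hK : ∀ t ∈ Icc (0:ℝ) ω, |P ⟨0, by omega⟩ t| < K)
    (ha : ∀ t ∈ Icc (0:ℝ) ω, ∀ i : Fin n, (i:ℕ) ≠ 0 → (i:ℕ) ≠ 1 →
      |P i t| ≤ (K - |P ⟨0, by omega⟩ t|) * sin (π / ((n:ℝ) - 2)) /
        (((n:ℝ) - 3) * K ^ (((i:ℕ):ℝ) / (n:ℝ))))
    (hb : ∀ t ∈ Icc (0:ℝ) ω,
      (K + |P ⟨0, by omega⟩ t| + |P ⟨n-1, by omega⟩ t| +
          (K - |P ⟨0, by omega⟩ t|) * sin (π / ((n:ℝ) - 2)))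
        / K ^ ((1:ℝ) / (n:ℝ)) ≤ |P ⟨1, by omega⟩ t|) :
    (∃ S : Finset ℝ, S.card ≤ 2 ∧ ∀ x : ℝ → ℝ, IsPeriodicSolR n ω P x →
      (∀ t ∈ Icc (0:ℝ) ω, 0 < x t) → x 0 ∈ S) ∧
    (∃ S : Finset ℝ, S.card ≤ 2 ∧ ∀ x : ℝ → ℝ, IsPeriodicSolR n ω P x →
      (∀ t ∈ Icc (0:ℝ) ω, x t < 0) → x 0 ∈ S) := by
  have h5 : (5:ℝ) ≤ n := by exact_mod_cast hn
  let C : ℝ → ℕ → ℝ := fun t k => if h : k < n then P ⟨k, h⟩ t else 1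
  have hC : ∀ t k (h : k < n), C t k = P ⟨k, h⟩ t := fun t k h => dif_pos h
  have hCn : ∀ t, C t n = 1 := fun t => dif_neg (lt_irrefl n)
  have hK0 : 0 < K := (abs_nonneg _).trans_lt (hK 0 ⟨le_rfl, hω.le⟩)
  have hne : ∀ t ∈ Icc (0:ℝ) ω, P ⟨1, by omega⟩ t ≠ 0 := by
    intro t ht
    refine abs_pos.1 (lt_of_lt_of_le (div_pos ?_ (Real.rpow_pos_of_pos hK0 _)) (hb t ht))
    have := mul_nonneg (sub_nonneg.2 (hK t ht).le) (sin_pi_div_nonneg hn)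
    positivity
  obtain ⟨σ, hσ, hσ1⟩ := exists_sign_mul_eq_abs isPreconnected_Icc (hP ⟨1, by omega⟩) hne
  have habs : |σ| = 1 := by rcases hσ with rfl | rfl <;> simp
  have hσσ : σ * σ = 1 := by rcases hσ with rfl | rfl <;> norm_num
  have hbd : ∀ t ∈ Icc (0:ℝ) ω, _ := fun t ht => coeff_bounds hn (a := C t) (K := K)
    (by rw [hC t 0 (by omega)]; exact hK t ht)
    (fun k hk => by
      obtain ⟨hk2, hkn⟩ := Finset.mem_Ico.1 hk
      rw [hC t 0 (by omega), hC t k hkn]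
      exact ha t ht ⟨k, hkn⟩ (by simp only; omega) (by simp only; omega))
    (by rw [hC t 0 (by omega), hC t 1 (by omega), hC t (n - 1) (by omega)]; exact hb t ht)
  have hR : 0 < (1 - 1 / (n:ℝ)) * K ^ ((1:ℝ) / (n:ℝ)) := by
    refine mul_pos ?_ (Real.rpow_pos_of_pos hK0 _)
    rw [sub_pos, div_lt_one (by linarith)]
    linarith
  constructor
  · obtain ⟨S, hS, hmem⟩ := exists_card_le_two_positive (by omega : 2 ≤ n) hω hσ
      (c := fun t k => σ * C t k) hR
      (by
        simp only [hCn, mul_one]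
        exact hσ.imp (fun h _ => h) (fun h _ => h))
      (fun t ht => by
        simp only [abs_mul, habs, one_mul, hCn, abs_one]
        rw [hC t 1 (by omega), hσ1 t ht, ← hC t 1 (by omega)]
        exact (hbd t ht).1)
      (fun t ht => by
        simp only [abs_mul, habs, one_mul]
        exact (hbd t ht).2)
    refine ⟨S, hS, fun x hx hpos => hmem x (fun t ht => (hx.1 t ht).congr_deriv ?_) hx.2 hpos⟩
    rw [splitPoly_const_mul, ← mul_assoc, hσσ, one_mul, fR_eq_splitPoly (by omega)]
  · obtain ⟨S, hS, hmem⟩ := exists_card_le_two_positive (by omega : 2 ≤ n) hω hσ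
      (c := fun t k => -σ * ((-1) ^ k * C t k)) hR
      (by
        simp only [hCn, mul_one]
        rcases neg_one_pow_eq_or ℝ n with h | h <;> rw [h] <;>
          rcases hσ with rfl | rfl <;> norm_num)
      (fun t ht => by
        simp only [abs_mul, abs_neg, habs, abs_pow, abs_one, one_pow, one_mul, hCn, pow_one]
        rw [neg_mul_comm, neg_one_mul, neg_neg, hC t 1 (by omega), hσ1 t ht,
          ← hC t 1 (by omega)]
        exact (hbd t ht).1)
      (fun t ht => by
        simp only [abs_mul, abs_neg, habs, abs_pow, abs_one, one_pow, one_mul]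
        exact (hbd t ht).2)
    classical
    refine ⟨S.image fun a => -a, Finset.card_image_le.trans hS, fun x hx hneg => ?_⟩
    refine Finset.mem_image.2 ⟨-x 0, hmem (fun t => -x t)
      (fun t ht => (hx.1 t ht).fun_neg.congr_deriv ?_) (by rw [hx.2])
      (fun t ht => neg_pos.2 (hneg t ht)), neg_neg _⟩
    rw [splitPoly_const_mul, splitPoly_comp_neg, neg_neg, ← mul_assoc, mul_neg, hσσ, neg_one_mul,
      fR_eq_splitPoly (by omega)]
end
end

section
/- Let n ≥ 5 be odd and let K be a real number with K > max_{0≤t≤ω} |P_0(t)|. Suppose that for all t ∈ [0,ω] and for every index i with i ≠ 0, 1 (including i = n−1): |P_i(t)| ≤ (K − |P_0(t)|)·sin(π/(n−2)) / ((n−3)·K^{i/n}), and |P_1(t)| ≥ (K + |P_0(t)| + |P_{n−1}(t)| + (K − |P_0(t)|)·sin(π/(n−2))) / K^{1/n}. Then equation (1.1) has at least one real periodic solution and at most three real periodic solutions. -/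
open Set Real Filter

noncomputable section

/-- `x` solves `x' = g t x` on `[0, ω]` with `x 0 = x ω`. -/
def IsPeriodicOrbit (ω : ℝ) (g : ℝ → ℝ → ℝ) (x : ℝ → ℝ) : Prop :=
  (∀ t ∈ Icc (0:ℝ) ω, HasDerivWithinAt x (g t (x t)) (Icc (0:ℝ) ω) t) ∧ x 0 = x ω

/-- A field with `g t x ≤ 0` above `c` does not let a solution climb past `c`. -/
theorem le_of_nonpos_above {ω c : ℝ} {g : ℝ → ℝ → ℝ} {x : ℝ → ℝ}
    (hx : ∀ t ∈ Icc (0:ℝ) ω, HasDerivWithinAt x (g t (x t)) (Icc (0:ℝ) ω) t)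
    (hg : ∀ t ∈ Icc (0:ℝ) ω, ∀ y, c ≤ y → g t y ≤ 0) (h0 : x 0 ≤ c) :
    ∀ t ∈ Icc (0:ℝ) ω, x t ≤ c := by
  intro t ht
  have key : ∀ ε > 0, x t ≤ c + ε * (1 + t) := by
    intro ε hε
    refine image_le_of_deriv_right_lt_deriv_boundary' (f := x) (f' := fun s => g s (x s))
      (B := fun s => c + ε * (1 + s)) (B' := fun _ => ε)
      (fun s hs => (hx s hs).continuousWithinAt) ?_ ?_ ?_ ?_ ?_ ht
    · intro s hs
      exact (hx s (Ico_subset_Icc_self hs)).mono_of_mem_nhdsWithin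
        (mem_of_superset (Icc_mem_nhdsGE hs.2) (Icc_subset_Icc_left hs.1))
    · simp only [add_zero, mul_one]; linarith
    · fun_prop
    · intro s _
      have h := (((hasDerivAt_id s).const_add 1).const_mul ε).const_add c
      simpa using h.hasDerivWithinAt
    · intro s hs hs'
      refine (hg s (Ico_subset_Icc_self hs) _ ?_).trans_lt hε
      rw [hs']
      have := hs.1
      have : 0 ≤ ε * (1 + s) := by positivity
      linarith
  refine le_of_forall_pos_le_add fun ε hε => ?_
  have h1 : 0 < 1 + t := by linarith [ht.1]
  have := key (ε / (1 + t)) (by positivity)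
  rwa [div_mul_cancel₀ _ h1.ne'] at this

/-- A Lipschitz field pointing weakly inwards at the ends of `[-1, 1]` has a periodic orbit. -/
theorem exists_isPeriodicOrbit_of_inward {ω : ℝ} (hω : 0 < ω) {g : ℝ → ℝ → ℝ} {L M : NNReal}
    (hL : ∀ t ∈ Icc (0:ℝ) ω, LipschitzOnWith L (g t) (Icc (-1) 1))
    (hc : ∀ y ∈ Icc (-1:ℝ) 1, ContinuousOn (fun t => g t y) (Icc 0 ω))
    (hM : ∀ t ∈ Icc (0:ℝ) ω, ∀ y ∈ Icc (-1:ℝ) 1, |g t y| ≤ M)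
    (h1 : ∀ t ∈ Icc (0:ℝ) ω, g t 1 ≤ 0) (h2 : ∀ t ∈ Icc (0:ℝ) ω, 0 ≤ g t (-1)) :
    ∃ x, IsPeriodicOrbit ω g x := by
  have h11 : (-1:ℝ) ≤ 1 := by norm_num
  set pr : ℝ → ℝ := fun y => (projIcc (-1:ℝ) 1 h11 y : ℝ) with hpr
  have hprL : LipschitzWith 1 pr := LipschitzWith.subtype_val _ |>.comp (LipschitzWith.projIcc h11)
    |>.weaken (by simp)
  have hprm : ∀ y, pr y ∈ Icc (-1:ℝ) 1 := fun y => (projIcc (-1:ℝ) 1 h11 y).2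
  have hpre : ∀ y ∈ Icc (-1:ℝ) 1, pr y = y := fun y hy => by simp [hpr, projIcc_of_mem _ hy]
  have hpr1 : ∀ y, 1 ≤ y → pr y = 1 := fun y hy => by simp [hpr, projIcc_of_right_le _ hy]
  have hpr2 : ∀ y, y ≤ -1 → pr y = -1 := fun y hy => by simp [hpr, projIcc_of_le_left _ hy]
  let t0 : Icc (0:ℝ) ω := ⟨0, by simp [hω.le]⟩
  have hPL : IsPicardLindelof (fun t y => g t (pr y)) t0 (0:ℝ) (1 + M * ω.toNNReal) 1 M L := by
    refine ⟨fun t ht => ?_, fun y _ => hc _ (hprm y), fun t ht y _ => hM t ht _ (hprm y), ?_⟩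
    · have := (hL t ht).comp (hprL.lipschitzOnWith
        (s := Metric.closedBall 0 (1 + M * ω.toNNReal : NNReal)))
        (fun y _ => hprm y)
      simpa [Function.comp_def] using this
    · simp only [t0, sub_zero, sub_self, NNReal.coe_add, NNReal.coe_one, add_sub_cancel_left]
      rw [max_eq_left hω.le, NNReal.coe_mul, Real.coe_toNNReal _ hω.le]
  obtain ⟨α, hα, hαc⟩ := hPL.exists_forall_mem_closedBall_eq_hasDerivWithinAt_continuousOn
  have hball : ∀ y ∈ Icc (-1:ℝ) 1, y ∈ Metric.closedBall (0:ℝ) ((1:NNReal):ℝ) := by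
    intro y hy
    simpa [abs_le] using hy
  have hin : ∀ y ∈ Icc (-1:ℝ) 1, ∀ t ∈ Icc (0:ℝ) ω, α (y, t) ∈ Icc (-1:ℝ) 1 := by
    intro y hy t ht
    obtain ⟨ha0, had⟩ := hα y (hball y hy)
    have ha0' : α (y, 0) = y := ha0
    constructor
    · have := le_of_nonpos_above (c := 1) (x := fun s => -α (y, s))
        (g := fun s z => -g s (pr (-z))) (fun s hs => by simpa using (had s hs).fun_neg)
        (fun s hs z hz => by simpa [hpr2 (-z) (by linarith)] using h2 s hs)
        (by simp only [ha0']; linarith [hy.1]) t ht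
      linarith
    · exact le_of_nonpos_above (c := 1) (x := fun s => α (y, s))
        (g := fun s z => g s (pr z)) had
        (fun s hs z hz => by simpa [hpr1 z hz] using h1 s hs)
        (by simp only [ha0']; exact hy.2) t ht
  have hcont : ContinuousOn (fun y => α (y, ω)) (Icc (-1) 1) :=
    hαc.comp (by fun_prop) fun y hy => ⟨hball y hy, by simp [hω.le]⟩
  have hωm : ω ∈ Icc (0:ℝ) ω := ⟨hω.le, le_rfl⟩
  obtain ⟨y, hy, hfix⟩ := exists_mem_Icc_isFixedPt_of_mapsTo hcont h11
    (fun y hy => hin y hy ω hωm)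
  obtain ⟨ha0, had⟩ := hα y (hball y hy)
  refine ⟨fun t => α (y, t), fun t ht => ?_, ?_⟩
  · simpa [hpre _ (hin y hy t ht)] using had t ht
  · exact ha0.trans hfix.symm

theorem exists_isPeriodicOrbit_of_outward {ω : ℝ} (hω : 0 < ω) {g : ℝ → ℝ → ℝ} {L M : NNReal}
    (hL : ∀ t ∈ Icc (0:ℝ) ω, LipschitzOnWith L (g t) (Icc (-1) 1))
    (hc : ∀ y ∈ Icc (-1:ℝ) 1, ContinuousOn (fun t => g t y) (Icc 0 ω))
    (hM : ∀ t ∈ Icc (0:ℝ) ω, ∀ y ∈ Icc (-1:ℝ) 1, |g t y| ≤ M)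
    (h1 : ∀ t ∈ Icc (0:ℝ) ω, 0 ≤ g t 1) (h2 : ∀ t ∈ Icc (0:ℝ) ω, g t (-1) ≤ 0) :
    ∃ x, IsPeriodicOrbit ω g x := by
  have hmaps : MapsTo (fun t => ω - t) (Icc (0:ℝ) ω) (Icc (0:ℝ) ω) := fun t ht =>
    ⟨by linarith [ht.2], by linarith [ht.1]⟩
  obtain ⟨x, hx, hx0⟩ := exists_isPeriodicOrbit_of_inward hω (g := fun t y => -g (ω - t) y)
    (L := L) (M := M) (fun t ht => (hL _ (hmaps ht)).neg)
    (fun y hy => ((hc y hy).comp (by fun_prop) hmaps).neg)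
    (fun t ht y hy => by simpa using hM _ (hmaps ht) y hy)
    (fun t ht => by simpa using h1 _ (hmaps ht)) (fun t ht => by simpa using h2 _ (hmaps ht))
  refine ⟨fun t => x (ω - t), fun t ht => ?_, by simpa using hx0.symm⟩
  have h := (hx _ (hmaps ht)).scomp t
    (((hasDerivAt_id t).const_sub ω).hasDerivWithinAt (s := Icc 0 ω)) hmaps
  simpa [Function.comp_def] using h

theorem exists_primitive_on_Icc {ω : ℝ} (hω : 0 ≤ ω) {q : ℝ → ℝ}
    (hq : ContinuousOn q (Icc 0 ω)) :
    ∃ Q : ℝ → ℝ, ∀ t ∈ Icc (0:ℝ) ω, HasDerivWithinAt Q (q t) (Icc 0 ω) t := by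
  have hc : Continuous (IccExtend hω ((Icc 0 ω).domRestrict q)) :=
    (continuousOn_iff_continuous_domRestrict.1 hq).Icc_extend'
  refine ⟨fun t => ∫ s in (0:ℝ)..t, IccExtend hω ((Icc 0 ω).domRestrict q) s, fun t ht => ?_⟩
  have h := (hc.integral_hasStrictDerivAt 0 t).hasDerivAt.hasDerivWithinAt (s := Icc 0 ω)
  rwa [IccExtend_of_mem _ _ ht] at h

/-- A solution of the linear equation `v' = q v + r` with `v 0 = v ω` and a forcing term of
constant sign is either positive throughout or nonpositive throughout. -/
theorem pos_or_nonpos_of_linear {ω : ℝ} (hω : 0 ≤ ω) {v q r : ℝ → ℝ}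
    (hq : ContinuousOn q (Icc 0 ω))
    (hv : ∀ t ∈ Icc (0:ℝ) ω, HasDerivWithinAt v (q t * v t + r t) (Icc 0 ω) t)
    (hr : (∀ t ∈ Icc (0:ℝ) ω, 0 ≤ r t) ∨ (∀ t ∈ Icc (0:ℝ) ω, r t ≤ 0)) (hper : v 0 = v ω) :
    (0 < v 0 → ∀ t ∈ Icc (0:ℝ) ω, 0 < v t) ∧ (v 0 ≤ 0 → ∀ t ∈ Icc (0:ℝ) ω, v t ≤ 0) := by
  obtain ⟨Q, hQ⟩ := exists_primitive_on_Icc hω hq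
  set w : ℝ → ℝ := fun t => v t * exp (-Q t) with hw
  have hwd : ∀ t ∈ Icc (0:ℝ) ω, HasDerivWithinAt w (r t * exp (-Q t)) (Icc 0 ω) t := by
    intro t ht
    refine ((hv t ht).fun_mul (hQ t ht).fun_neg.exp).congr_deriv ?_
    ring
  have hwc : ContinuousOn w (Icc 0 ω) := fun t ht => (hwd t ht).continuousWithinAt
  have hwi : ∀ t ∈ interior (Icc (0:ℝ) ω),
      HasDerivWithinAt w (r t * exp (-Q t)) (interior (Icc 0 ω)) t :=
    fun t ht => (hwd t (interior_subset ht)).mono interior_subset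
  have hpos : ∀ t, 0 < w t ↔ 0 < v t := fun t => by
    simp only [hw]; exact mul_pos_iff_of_pos_right (exp_pos _)
  have hnonpos : ∀ t, w t ≤ 0 ↔ v t ≤ 0 := fun t => by
    rw [← not_lt, ← not_lt, hpos]
  have h0 : (0:ℝ) ∈ Icc (0:ℝ) ω := ⟨le_rfl, hω⟩
  have h1 : ω ∈ Icc (0:ℝ) ω := ⟨hω, le_rfl⟩
  rcases hr with hr | hr
  · have hmono : MonotoneOn w (Icc 0 ω) := monotoneOn_of_hasDerivWithinAt_nonneg
      (convex_Icc _ _) hwc hwi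
      fun t ht => mul_nonneg (hr t (interior_subset ht)) (exp_pos _).le
    refine ⟨fun h t ht => ?_, fun h t ht => ?_⟩
    · exact (hpos t).1 (((hpos 0).2 h).trans_le (hmono h0 ht ht.1))
    · exact (hnonpos t).1 ((hmono ht h1 ht.2).trans ((hnonpos ω).2 (hper ▸ h)))
  · have hanti : AntitoneOn w (Icc 0 ω) := antitoneOn_of_hasDerivWithinAt_nonpos
      (convex_Icc _ _) hwc hwi
      fun t ht => mul_nonpos_of_nonpos_of_nonneg (hr t (interior_subset ht)) (exp_pos _).le
    refine ⟨fun h t ht => ?_, fun h t ht => ?_⟩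
    · exact (hpos t).1 (((hpos ω).2 (hper ▸ h)).trans_le (hanti ht h1 ht.2))
    · exact (hnonpos t).1 ((hanti h0 ht ht.1).trans ((hnonpos 0).2 h))

/-- The time-dependent polynomial `∑ i ≤ n, b i t * x ^ i`. -/
def polyField (n : ℕ) (b : ℕ → ℝ → ℝ) (t x : ℝ) : ℝ :=
  ∑ i ∈ Finset.range (n + 1), b i t * x ^ i

/-- The difference quotient of `polyField n b t` between `x` and `y`. -/
def polyFieldSlope (n : ℕ) (b : ℕ → ℝ → ℝ) (t x y : ℝ) : ℝ :=
  ∑ i ∈ Finset.range (n + 1), b i t * ∑ j ∈ Finset.range i, x ^ j * y ^ (i - 1 - j)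

theorem polyFieldSlope_mul_sub (n : ℕ) (b : ℕ → ℝ → ℝ) (t x y : ℝ) :
    polyFieldSlope n b t x y * (x - y) = polyField n b t x - polyField n b t y := by
  simp only [polyFieldSlope, polyField, Finset.sum_mul, mul_assoc, ← Finset.sum_sub_distrib,
    ← mul_sub]
  refine Finset.sum_congr rfl fun i _ => ?_
  rw [← geom_sum₂_mul, Finset.sum_mul]
  simp only [mul_assoc]

theorem continuousOn_polyFieldSlope {n : ℕ} {b : ℕ → ℝ → ℝ} {s : Set ℝ}
    (hb : ∀ i, ContinuousOn (b i) s) {x y : ℝ → ℝ} (hx : ContinuousOn x s)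
    (hy : ContinuousOn y s) : ContinuousOn (fun t => polyFieldSlope n b t (x t) (y t)) s := by
  unfold polyFieldSlope
  fun_prop

theorem IsPeriodicOrbit.continuousOn {ω : ℝ} {g : ℝ → ℝ → ℝ} {x : ℝ → ℝ}
    (hx : IsPeriodicOrbit ω g x) : ContinuousOn x (Icc 0 ω) :=
  fun t ht => (hx.1 t ht).continuousWithinAt

/-- Distinct periodic orbits of a polynomial field do not cross. -/
theorem IsPeriodicOrbit.lt_of_lt {ω : ℝ} (hω : 0 ≤ ω) {n : ℕ} {b : ℕ → ℝ → ℝ}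
    (hb : ∀ i, ContinuousOn (b i) (Icc 0 ω)) {x y : ℝ → ℝ}
    (hx : IsPeriodicOrbit ω (polyField n b) x) (hy : IsPeriodicOrbit ω (polyField n b) y)
    (h : x 0 < y 0) : ∀ t ∈ Icc (0:ℝ) ω, x t < y t := by
  have key := pos_or_nonpos_of_linear hω (v := fun t => y t - x t)
    (q := fun t => polyFieldSlope n b t (y t) (x t)) (r := fun _ => 0)
    (continuousOn_polyFieldSlope hb hy.continuousOn hx.continuousOn)
    (fun t ht => by
      rw [polyFieldSlope_mul_sub, add_zero]
      exact (hy.1 t ht).fun_sub (hx.1 t ht))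
    (Or.inl fun _ _ => le_rfl) (by simp only [hx.2, hy.2])
  exact fun t ht => sub_pos.1 (key.1 (sub_pos.2 h) t ht)

/-- A level `c` on which the field has constant sign is not crossed by periodic orbits. -/
theorem IsPeriodicOrbit.level {ω : ℝ} (hω : 0 ≤ ω) {n : ℕ} {b : ℕ → ℝ → ℝ}
    (hb : ∀ i, ContinuousOn (b i) (Icc 0 ω)) {x : ℝ → ℝ} {c : ℝ}
    (hx : IsPeriodicOrbit ω (polyField n b) x)
    (hc : (∀ t ∈ Icc (0:ℝ) ω, 0 ≤ polyField n b t c) ∨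
      (∀ t ∈ Icc (0:ℝ) ω, polyField n b t c ≤ 0)) :
    ((x 0 < c → ∀ t ∈ Icc (0:ℝ) ω, x t < c) ∧ (c ≤ x 0 → ∀ t ∈ Icc (0:ℝ) ω, c ≤ x t)) ∧
    ((c < x 0 → ∀ t ∈ Icc (0:ℝ) ω, c < x t) ∧ (x 0 ≤ c → ∀ t ∈ Icc (0:ℝ) ω, x t ≤ c)) := by
  have hq := continuousOn_polyFieldSlope (n := n) hb hx.continuousOn
    (continuousOn_const (c := c))
  have below := pos_or_nonpos_of_linear hω (v := fun t => c - x t)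
    (q := fun t => polyFieldSlope n b t (x t) c) (r := fun t => -polyField n b t c) hq
    (fun t ht => by
      refine ((hx.1 t ht).const_sub c).congr_deriv ?_
      linear_combination polyFieldSlope_mul_sub n b t (x t) c)
    (hc.symm.imp (fun h t ht => by simpa using h t ht) (fun h t ht => by simpa using h t ht))
    (by simp only [hx.2])
  have above := pos_or_nonpos_of_linear hω (v := fun t => x t - c)
    (q := fun t => polyFieldSlope n b t (x t) c) (r := fun t => polyField n b t c) hq
    (fun t ht => by
      refine ((hx.1 t ht).sub_const c).congr_deriv ?_
      linear_combination -polyFieldSlope_mul_sub n b t (x t) c)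
    hc (by simp only [hx.2])
  simpa only [sub_pos, sub_nonpos] using And.intro below above

/-- Two periodic orbits cannot both stay in a region where the field, read in the coordinate
`F`, is strictly monotone. -/
theorem IsPeriodicOrbit.not_lt_of_strictMono {ω : ℝ} (hω : 0 < ω) {n : ℕ} {b : ℕ → ℝ → ℝ}
    (hb : ∀ i, ContinuousOn (b i) (Icc 0 ω)) {s : Set ℝ} {F F' : ℝ → ℝ}
    (hF : ∀ y ∈ s, HasDerivAt F (F' y) y)
    (hmono : (∀ t ∈ Icc (0:ℝ) ω, StrictMonoOn (fun y => F' y * polyField n b t y) s) ∨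
      (∀ t ∈ Icc (0:ℝ) ω, StrictAntiOn (fun y => F' y * polyField n b t y) s))
    {x y : ℝ → ℝ} (hx : IsPeriodicOrbit ω (polyField n b) x)
    (hy : IsPeriodicOrbit ω (polyField n b) y)
    (hxs : ∀ t ∈ Icc (0:ℝ) ω, x t ∈ s) (hys : ∀ t ∈ Icc (0:ℝ) ω, y t ∈ s) : ¬ x 0 < y 0 := by
  intro hlt
  have hxy := hx.lt_of_lt hω.le hb hy hlt
  have hd : ∀ t ∈ Icc (0:ℝ) ω, HasDerivWithinAt (fun t => F (y t) - F (x t))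
      (F' (y t) * polyField n b t (y t) - F' (x t) * polyField n b t (x t)) (Icc 0 ω) t :=
    fun t ht => ((hF _ (hys t ht)).comp_hasDerivWithinAt t (hy.1 t ht)).fun_sub
      ((hF _ (hxs t ht)).comp_hasDerivWithinAt t (hx.1 t ht))
  have hc : ContinuousOn (fun t => F (y t) - F (x t)) (Icc 0 ω) :=
    fun t ht => (hd t ht).continuousWithinAt
  have hi : ∀ t ∈ interior (Icc (0:ℝ) ω), HasDerivWithinAt (fun t => F (y t) - F (x t))
      (F' (y t) * polyField n b t (y t) - F' (x t) * polyField n b t (x t))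
      (interior (Icc 0 ω)) t :=
    fun t ht => (hd t (interior_subset ht)).mono interior_subset
  have h0 : (0:ℝ) ∈ Icc (0:ℝ) ω := ⟨le_rfl, hω.le⟩
  have h1 : ω ∈ Icc (0:ℝ) ω := ⟨hω.le, le_rfl⟩
  have heq : F (y 0) - F (x 0) = F (y ω) - F (x ω) := by rw [hx.2, hy.2]
  rcases hmono with hm | hm
  · have := strictMonoOn_of_hasDerivWithinAt_pos (convex_Icc _ _) hc hi fun t ht =>
      sub_pos.2 (hm t (interior_subset ht) (hxs t (interior_subset ht))
        (hys t (interior_subset ht)) (hxy t (interior_subset ht)))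
    exact (this h0 h1 hω).ne heq
  · have := strictAntiOn_of_hasDerivWithinAt_neg (convex_Icc _ _) hc hi fun t ht =>
      sub_neg.2 (hm t (interior_subset ht) (hxs t (interior_subset ht))
        (hys t (interior_subset ht)) (hxy t (interior_subset ht)))
    exact (this h0 h1 hω).ne' heq

theorem IsPeriodicOrbit.zero_eq {ω : ℝ} (hω : 0 < ω) {n : ℕ} {b : ℕ → ℝ → ℝ}
    (hb : ∀ i, ContinuousOn (b i) (Icc 0 ω)) {s : Set ℝ} {F F' : ℝ → ℝ}
    (hF : ∀ y ∈ s, HasDerivAt F (F' y) y)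
    (hmono : (∀ t ∈ Icc (0:ℝ) ω, StrictMonoOn (fun y => F' y * polyField n b t y) s) ∨
      (∀ t ∈ Icc (0:ℝ) ω, StrictAntiOn (fun y => F' y * polyField n b t y) s))
    {x y : ℝ → ℝ} (hx : IsPeriodicOrbit ω (polyField n b) x)
    (hy : IsPeriodicOrbit ω (polyField n b) y)
    (hxs : ∀ t ∈ Icc (0:ℝ) ω, x t ∈ s) (hys : ∀ t ∈ Icc (0:ℝ) ω, y t ∈ s) : x 0 = y 0 :=
  le_antisymm (not_lt.1 (hy.not_lt_of_strictMono hω hb hF hmono hx hys hxs))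
    (not_lt.1 (hx.not_lt_of_strictMono hω hb hF hmono hy hxs hys))

theorem hasDerivAt_polyField (n : ℕ) (b : ℕ → ℝ → ℝ) (t y : ℝ) :
    HasDerivAt (polyField n b t)
      (∑ i ∈ Finset.range (n + 1), b i t * (i * y ^ (i - 1))) y :=
  HasDerivAt.fun_sum fun i _ => (hasDerivAt_pow i y).const_mul (b i t)

theorem hasDerivAt_inv_mul_polyField (n : ℕ) (b : ℕ → ℝ → ℝ) (t : ℝ) {y : ℝ} (hy : y ≠ 0) :
    HasDerivAt (fun z => z⁻¹ * polyField n b t z)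
      ((∑ i ∈ Finset.range (n + 1), ((i:ℝ) - 1) * b i t * y ^ i) / y ^ 2) y := by
  refine ((hasDerivAt_inv hy).mul (hasDerivAt_polyField n b t y)).congr_deriv ?_
  have h : ∑ i ∈ Finset.range (n + 1), ((i:ℝ) - 1) * b i t * y ^ i
      = y * (∑ i ∈ Finset.range (n + 1), b i t * (i * y ^ (i - 1))) - polyField n b t y := by
    rw [polyField, Finset.mul_sum, ← Finset.sum_sub_distrib]
    refine Finset.sum_congr rfl fun i _ => ?_
    rcases i with _ | i
    · simp
    · rw [Nat.add_sub_cancel, pow_succ]; ring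
  rw [h]
  field_simp
  ring

theorem hasDerivAt_inv_one_sub_sq_mul_polyField (n : ℕ) (b : ℕ → ℝ → ℝ) (t : ℝ) {y : ℝ}
    (hy : 1 - y ^ 2 ≠ 0) :
    HasDerivAt (fun z => (1 - z ^ 2)⁻¹ * polyField n b t z)
      ((∑ i ∈ Finset.range (n + 1), b i t * (i * y ^ (i - 1) * (1 - y ^ 2) + 2 * y ^ (i + 1)))
        / (1 - y ^ 2) ^ 2) y := by
  have h1 : HasDerivAt (fun z : ℝ => 1 - z ^ 2) (-(2 * y)) y := by
    simpa using (hasDerivAt_pow 2 y).const_sub 1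
  refine ((h1.fun_inv hy).mul (hasDerivAt_polyField n b t y)).congr_deriv ?_
  have h : ∑ i ∈ Finset.range (n + 1), b i t * (i * y ^ (i - 1) * (1 - y ^ 2) + 2 * y ^ (i + 1))
      = (1 - y ^ 2) * (∑ i ∈ Finset.range (n + 1), b i t * (i * y ^ (i - 1)))
        + 2 * y * polyField n b t y := by
    rw [polyField, Finset.mul_sum, Finset.mul_sum, ← Finset.sum_add_distrib]
    refine Finset.sum_congr rfl fun i _ => ?_
    rw [pow_succ]; ring
  rw [h]
  field_simp
  ring

theorem hyperbolic_kernel_lt {r : ℝ} (h0 : 0 ≤ r) (h1 : r < 1) (j : ℕ) :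
    (j + 2) * r ^ (j + 1) * (1 - r ^ 2) + 2 * r ^ (j + 3) < 1 + r ^ 2 := by
  induction j with
  | zero =>
    norm_num
    nlinarith [mul_pos (sub_pos.2 h1) (sub_pos.2 h1)]
  | succ j ih =>
    have : 0 ≤ r ^ (j + 1) * ((1 - r) ^ 2 * ((j + 2) + (j + 1) * r)) := by positivity
    push_cast
    refine lt_of_le_of_lt ?_ ih
    rw [← sub_nonneg]
    refine this.trans_eq ?_
    ring

theorem abs_hyperbolic_kernel_lt {y : ℝ} (hy : |y| < 1) {i : ℕ} (hi : i ≠ 1) :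
    |i * y ^ (i - 1) * (1 - y ^ 2) + 2 * y ^ (i + 1)| < 1 + y ^ 2 := by
  have h2 : 0 ≤ 1 - y ^ 2 := by
    rw [← sq_abs]; nlinarith [abs_nonneg y]
  match i, hi with
  | 0, _ =>
    have : |2 * y| < 1 + y ^ 2 := by
      rw [← sq_abs y, abs_mul, abs_two]
      nlinarith [mul_pos (sub_pos.2 hy) (sub_pos.2 hy)]
    simpa using this
  | j + 2, _ =>
    have h := hyperbolic_kernel_lt (abs_nonneg y) hy j
    rw [sq_abs] at h
    refine lt_of_le_of_lt ((abs_add_le _ _).trans_eq ?_) h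
    rw [abs_mul, abs_mul, abs_mul, abs_pow, abs_pow, abs_of_nonneg h2, abs_two]
    congr 3
    push_cast
    exact abs_of_nonneg (by positivity)

theorem abs_sum_erase_lt {n : ℕ} (hn : 2 ≤ n) {c e : ℕ → ℝ} (hcn : 0 < c n)
    (hdom : ∑ i ∈ (Finset.range (n + 1)).erase 1, |c i| ≤ |c 1|) {m : ℝ}
    (he : ∀ i ≠ 1, |e i| < m) :
    |∑ i ∈ (Finset.range (n + 1)).erase 1, c i * e i| < |c 1| * m := by
  have hm : 0 < m := (abs_nonneg _).trans_lt (he 0 (by norm_num))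
  have hmem : n ∈ (Finset.range (n + 1)).erase 1 := by simp; omega
  calc |∑ i ∈ (Finset.range (n + 1)).erase 1, c i * e i|
      ≤ ∑ i ∈ (Finset.range (n + 1)).erase 1, |c i * e i| := Finset.abs_sum_le_sum_abs _ _
    _ < ∑ i ∈ (Finset.range (n + 1)).erase 1, |c i| * m := by
        refine Finset.sum_lt_sum (fun i hi => ?_) ⟨n, hmem, ?_⟩
        · rw [abs_mul]
          exact mul_le_mul_of_nonneg_left (he i (Finset.ne_of_mem_erase hi)).le (abs_nonneg _)
        · rw [abs_mul]
          exact mul_lt_mul_of_pos_left (he n (by omega)) (abs_pos.2 hcn.ne')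
    _ ≤ |c 1| * m := by
        rw [← Finset.sum_mul]
        exact mul_le_mul_of_nonneg_right hdom hm.le

theorem strictMonoOn_or_strictAntiOn_unit {n : ℕ} (hn : 2 ≤ n) {b : ℕ → ℝ → ℝ} {t : ℝ}
    (hbn : 0 < b n t)
    (hdom : ∑ i ∈ (Finset.range (n + 1)).erase 1, |b i t| ≤ |b 1 t|) :
    (0 < b 1 t → StrictMonoOn (fun y => (1 - y ^ 2)⁻¹ * polyField n b t y) (Ioo (-1) 1)) ∧
    (b 1 t < 0 → StrictAntiOn (fun y => (1 - y ^ 2)⁻¹ * polyField n b t y) (Ioo (-1) 1)) := by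
  have hne : ∀ y ∈ Ioo (-1:ℝ) 1, 0 < 1 - y ^ 2 := fun y hy => by nlinarith [hy.1, hy.2]
  have hd : ∀ y ∈ Ioo (-1:ℝ) 1, HasDerivAt (fun z => (1 - z ^ 2)⁻¹ * polyField n b t z)
      ((∑ i ∈ Finset.range (n + 1), b i t * (i * y ^ (i - 1) * (1 - y ^ 2) + 2 * y ^ (i + 1)))
        / (1 - y ^ 2) ^ 2) y := fun y hy =>
    hasDerivAt_inv_one_sub_sq_mul_polyField n b t (hne y hy).ne'
  have hc : ContinuousOn (fun z => (1 - z ^ 2)⁻¹ * polyField n b t z) (Ioo (-1) 1) :=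
    fun y hy => (hd y hy).continuousAt.continuousWithinAt
  have key : ∀ y ∈ Ioo (-1:ℝ) 1, ∃ R, |R| < |b 1 t| * (1 + y ^ 2) ∧
      ∑ i ∈ Finset.range (n + 1), b i t * (i * y ^ (i - 1) * (1 - y ^ 2) + 2 * y ^ (i + 1))
        = b 1 t * (1 + y ^ 2) + R := by
    intro y hy
    refine ⟨_, abs_sum_erase_lt hn (c := fun i => b i t) hbn hdom
      (fun i hi => abs_hyperbolic_kernel_lt (abs_lt.2 hy) hi), ?_⟩
    rw [← Finset.add_sum_erase _ _ (show 1 ∈ Finset.range (n + 1) by simp; omega)]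
    congr 1
    simp only [Nat.cast_one, Nat.sub_self, pow_zero]
    ring
  rw [← interior_Ioo] at hd
  refine ⟨fun h => strictMonoOn_of_deriv_pos (convex_Ioo _ _) hc fun y hy => ?_,
    fun h => strictAntiOn_of_deriv_neg (convex_Ioo _ _) hc fun y hy => ?_⟩
  all_goals
    rw [(hd y hy).deriv]
    rw [interior_Ioo] at hy
    obtain ⟨R, hR, hs⟩ := key y hy
    rw [hs]
    have := hne y hy
    rw [abs_lt] at hR
  · rw [abs_of_pos h] at hR
    exact div_pos (by linarith [hR.1]) (by positivity)
  · rw [abs_of_neg h] at hR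
    exact div_neg_of_neg_of_pos (by linarith [hR.2]) (by positivity)

theorem sum_mul_pow_pos_of_dominant {n : ℕ} {c : ℕ → ℝ}
    (hdom : ∑ i ∈ Finset.range n, |c i| < c n) {y : ℝ} (hy : 1 ≤ |y|) :
    0 < y ^ n * ∑ i ∈ Finset.range (n + 1), c i * y ^ i := by
  have hy0 : 0 < |y| ^ n := by positivity
  have h1 : |∑ i ∈ Finset.range n, c i * y ^ i| < c n * |y| ^ n := by
    calc |∑ i ∈ Finset.range n, c i * y ^ i|
        ≤ ∑ i ∈ Finset.range n, |c i * y ^ i| := Finset.abs_sum_le_sum_abs _ _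
      _ ≤ ∑ i ∈ Finset.range n, |c i| * |y| ^ n := by
          refine Finset.sum_le_sum fun i hi => ?_
          rw [abs_mul, abs_pow]
          exact mul_le_mul_of_nonneg_left
            (pow_le_pow_right₀ hy (Finset.mem_range.1 hi).le) (abs_nonneg _)
      _ < c n * |y| ^ n := by
          rw [← Finset.sum_mul]
          exact mul_lt_mul_of_pos_right hdom hy0
  have h2 : |y ^ n * ∑ i ∈ Finset.range n, c i * y ^ i| < c n * (y ^ n * y ^ n) := by
    rw [abs_mul, abs_pow, ← abs_mul_abs_self (y ^ n), abs_pow]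
    nlinarith
  rw [Finset.sum_range_succ]
  nlinarith [(abs_lt.1 h2).1]

theorem strictMonoOn_Ici_strictAntiOn_Iic {n : ℕ} (hodd : Odd n) {b : ℕ → ℝ → ℝ} {t : ℝ}
    (hext : ∑ i ∈ Finset.range n, |((i:ℝ) - 1) * b i t| < ((n:ℝ) - 1) * b n t) :
    StrictMonoOn (fun y => y⁻¹ * polyField n b t y) (Ici 1) ∧
    StrictAntiOn (fun y => y⁻¹ * polyField n b t y) (Iic (-1)) := by
  have key := fun y (hy : 1 ≤ |y|) =>
    sum_mul_pow_pos_of_dominant (c := fun i => ((i:ℝ) - 1) * b i t) hext hy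
  have hne : ∀ y : ℝ, 1 ≤ |y| → y ≠ 0 := fun y hy h => by norm_num [h] at hy
  have h1 : ∀ y ∈ Ici (1:ℝ), 1 ≤ |y| := fun y hy => le_trans hy (le_abs_self y)
  have h2 : ∀ y ∈ Iic (-1:ℝ), 1 ≤ |y| := fun y hy =>
    le_trans (by linarith [mem_Iic.1 hy]) (neg_le_abs y)
  refine ⟨strictMonoOn_of_deriv_pos (convex_Ici _) (fun y hy => ?_) fun y hy => ?_,
    strictAntiOn_of_deriv_neg (convex_Iic _) (fun y hy => ?_) fun y hy => ?_⟩
  · exact (hasDerivAt_inv_mul_polyField n b t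
      (hne y (h1 y hy))).continuousAt.continuousWithinAt
  · have hy1 := h1 y (interior_subset hy)
    have hy0 : 0 < y := one_pos.trans_le (interior_subset hy : y ∈ Ici (1:ℝ))
    rw [(hasDerivAt_inv_mul_polyField n b t (hne y hy1)).deriv]
    exact div_pos ((pos_iff_pos_of_mul_pos (key y hy1)).1 (by positivity)) (by positivity)
  · exact (hasDerivAt_inv_mul_polyField n b t
      (hne y (h2 y hy))).continuousAt.continuousWithinAt
  · have hy1 := h2 y (interior_subset hy)
    have hy0 : y < 0 := lt_of_le_of_lt (interior_subset hy : y ∈ Iic (-1:ℝ)) (by norm_num)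
    rw [(hasDerivAt_inv_mul_polyField n b t (hne y hy1)).deriv]
    exact div_neg_of_neg_of_pos
      ((neg_iff_neg_of_mul_pos (key y hy1)).1 (hodd.pow_neg hy0)) (sq_pos_of_neg hy0)

theorem abs_polyField_sub_le {n : ℕ} (hn : 1 ≤ n) {b : ℕ → ℝ → ℝ} {t : ℝ}
    (hdom : ∑ i ∈ (Finset.range (n + 1)).erase 1, |b i t| ≤ |b 1 t|) {c : ℝ} (hc : |c| = 1) :
    |polyField n b t c - b 1 t * c| ≤ |b 1 t| := by
  rw [polyField, ← Finset.add_sum_erase _ _ (show 1 ∈ Finset.range (n + 1) by simp; omega),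
    pow_one, add_sub_cancel_left]
  refine ((Finset.abs_sum_le_sum_abs _ _).trans_eq ?_).trans hdom
  simp [abs_mul, abs_pow, hc]

theorem pos_or_neg_of_continuousOn {ω : ℝ} {f : ℝ → ℝ}
    (hf : ContinuousOn f (Icc 0 ω)) (h0 : ∀ t ∈ Icc (0:ℝ) ω, f t ≠ 0) :
    (∀ t ∈ Icc (0:ℝ) ω, 0 < f t) ∨ (∀ t ∈ Icc (0:ℝ) ω, f t < 0) := by
  by_contra! hcon
  obtain ⟨⟨s, hs, hs'⟩, u, hu, hu'⟩ := hcon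
  obtain ⟨t, ht, ht'⟩ := isPreconnected_Icc.intermediate_value hs hu hf ⟨hs', hu'⟩
  exact h0 t ht ht'

theorem lipschitzOnWith_polyField {n : ℕ} {b : ℕ → ℝ → ℝ} {t : ℝ} {M : NNReal}
    (hM : ∑ i ∈ Finset.range (n + 1), |b i t| ≤ M) :
    LipschitzOnWith (M * n) (polyField n b t) (Icc (-1) 1) := by
  refine LipschitzOnWith.of_dist_le_mul fun x hx y hy => ?_
  rw [Real.dist_eq, Real.dist_eq, ← polyFieldSlope_mul_sub, abs_mul]
  refine mul_le_mul_of_nonneg_right ?_ (abs_nonneg _)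
  push_cast
  refine (Finset.abs_sum_le_sum_abs _ _).trans ?_
  refine le_trans ?_ (mul_le_mul_of_nonneg_right hM n.cast_nonneg)
  rw [Finset.sum_mul]
  refine Finset.sum_le_sum fun i hi => ?_
  rw [abs_mul]
  refine mul_le_mul_of_nonneg_left ?_ (abs_nonneg _)
  calc |∑ j ∈ Finset.range i, x ^ j * y ^ (i - 1 - j)|
      ≤ ∑ j ∈ Finset.range i, |x ^ j * y ^ (i - 1 - j)| := Finset.abs_sum_le_sum_abs _ _
    _ ≤ ∑ j ∈ Finset.range i, (1:ℝ) := by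
        refine Finset.sum_le_sum fun j _ => ?_
        rw [abs_mul, abs_pow, abs_pow]
        exact mul_le_one₀ (pow_le_one₀ (abs_nonneg _) (abs_le.2 hx)) (by positivity)
          (pow_le_one₀ (abs_nonneg _) (abs_le.2 hy))
    _ ≤ n := by
        simp only [Finset.sum_const, Finset.card_range, nsmul_eq_mul, mul_one, Nat.cast_le]
        have := Finset.mem_range.1 hi
        omega

theorem abs_polyField_le {n : ℕ} {b : ℕ → ℝ → ℝ} {t M : ℝ}
    (hM : ∑ i ∈ Finset.range (n + 1), |b i t| ≤ M) {y : ℝ} (hy : y ∈ Icc (-1:ℝ) 1) :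
    |polyField n b t y| ≤ M := by
  refine ((Finset.abs_sum_le_sum_abs _ _).trans (Finset.sum_le_sum fun i _ => ?_)).trans hM
  rw [abs_mul, abs_pow]
  exact mul_le_of_le_one_right (abs_nonneg _) (pow_le_one₀ (abs_nonneg _) (abs_le.2 hy))

/-- A polynomial field of odd degree whose linear coefficient dominates on `[-1, 1]` and whose
leading coefficient dominates outside has at least one and at most three periodic orbits. -/
theorem exists_and_encard_isPeriodicOrbit_polyField {n : ℕ} (hn : 2 ≤ n) (hodd : Odd n)
    {ω : ℝ} (hω : 0 < ω) {b : ℕ → ℝ → ℝ} (hb : ∀ i, ContinuousOn (b i) (Icc 0 ω))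
    (hbn : ∀ t ∈ Icc (0:ℝ) ω, 0 < b n t)
    (hdom : ∀ t ∈ Icc (0:ℝ) ω, ∑ i ∈ (Finset.range (n + 1)).erase 1, |b i t| ≤ |b 1 t|)
    (hext : ∀ t ∈ Icc (0:ℝ) ω,
      ∑ i ∈ Finset.range n, |((i:ℝ) - 1) * b i t| < ((n:ℝ) - 1) * b n t) :
    (∃ x, IsPeriodicOrbit ω (polyField n b) x) ∧
    {a | ∃ x, IsPeriodicOrbit ω (polyField n b) x ∧ x 0 = a}.encard ≤ 3 := by
  have hb1 : ∀ t ∈ Icc (0:ℝ) ω, b 1 t ≠ 0 := fun t ht h => by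
    have h1 := Finset.single_le_sum (f := fun i => |b i t|) (fun i _ => abs_nonneg _)
      (show n ∈ (Finset.range (n + 1)).erase 1 by simp; omega)
    have h2 := (h1.trans (hdom t ht)).trans_eq (by rw [h, abs_zero])
    exact (abs_pos.2 (hbn t ht).ne').not_ge h2
  have hsign := pos_or_neg_of_continuousOn (hb 1) hb1
  have hone : ∀ t ∈ Icc (0:ℝ) ω, |polyField n b t 1 - b 1 t * 1| ≤ |b 1 t| := fun t ht =>
    abs_polyField_sub_le (by omega) (hdom t ht) (by simp)
  have hneg : ∀ t ∈ Icc (0:ℝ) ω, |polyField n b t (-1) - b 1 t * (-1)| ≤ |b 1 t| := fun t ht =>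
    abs_polyField_sub_le (by omega) (hdom t ht) (by simp)
  have hends : (∀ t ∈ Icc (0:ℝ) ω, 0 ≤ polyField n b t 1 ∧ polyField n b t (-1) ≤ 0) ∨
      (∀ t ∈ Icc (0:ℝ) ω, polyField n b t 1 ≤ 0 ∧ 0 ≤ polyField n b t (-1)) := by
    refine hsign.imp (fun h t ht => ?_) (fun h t ht => ?_)
    all_goals
      have h1 := abs_le.1 (hone t ht)
      have h2 := abs_le.1 (hneg t ht)
    · rw [abs_of_pos (h t ht)] at h1 h2
      constructor <;> linarith [h1.1, h2.2]
    · rw [abs_of_neg (h t ht)] at h1 h2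
      constructor <;> linarith [h1.2, h2.1]
  constructor
  · obtain ⟨M, hM⟩ := isCompact_Icc.exists_bound_of_continuousOn
      (f := fun t => ∑ i ∈ Finset.range (n + 1), |b i t|) (s := Icc 0 ω) (by fun_prop)
    have hM' : ∀ t ∈ Icc (0:ℝ) ω, ∑ i ∈ Finset.range (n + 1), |b i t| ≤ M.toNNReal := fun t ht =>
      ((le_abs_self _).trans (hM t ht)).trans (Real.le_coe_toNNReal M)
    have hc : ∀ y ∈ Icc (-1:ℝ) 1, ContinuousOn (fun t => polyField n b t y) (Icc 0 ω) := by
      intro y _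
      unfold polyField
      fun_prop
    have hL := fun t ht => lipschitzOnWith_polyField (hM' t ht)
    have hB : ∀ t ∈ Icc (0:ℝ) ω, ∀ y ∈ Icc (-1:ℝ) 1, |polyField n b t y| ≤ M.toNNReal :=
      fun t ht y hy => abs_polyField_le (hM' t ht) hy
    rcases hends with h | h
    · exact exists_isPeriodicOrbit_of_outward hω hL hc hB (fun t ht => (h t ht).1)
        (fun t ht => (h t ht).2)
    · exact exists_isPeriodicOrbit_of_inward hω hL hc hB (fun t ht => (h t ht).1)
        (fun t ht => (h t ht).2)
  · set T := {a | ∃ x, IsPeriodicOrbit ω (polyField n b) x ∧ x 0 = a} with hT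
    have hl1 := fun x (hx : IsPeriodicOrbit ω (polyField n b) x) => hx.level hω.le hb (c := 1)
      (hends.imp (fun h t ht => (h t ht).1) (fun h t ht => (h t ht).1))
    have hl2 := fun x (hx : IsPeriodicOrbit ω (polyField n b) x) => hx.level hω.le hb (c := -1)
      (hends.symm.imp (fun h t ht => (h t ht).2) (fun h t ht => (h t ht).2))
    have hlog : ∀ y : ℝ, y ≠ 0 → HasDerivAt log y⁻¹ y := fun y hy => hasDerivAt_log hy
    have hA : (T ∩ Ici 1).Subsingleton := by
      rintro _ ⟨⟨x, hx, rfl⟩, hx0⟩ _ ⟨⟨y, hy, rfl⟩, hy0⟩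
      exact hx.zero_eq hω hb (s := Ici 1) (F := log) (F' := fun y => y⁻¹)
        (fun y hy => hlog y (one_pos.trans_le hy).ne')
        (Or.inl fun t ht => (strictMonoOn_Ici_strictAntiOn_Iic hodd (hext t ht)).1) hy
        ((hl1 x hx).1.2 hx0) ((hl1 y hy).1.2 hy0)
    have hC : (T ∩ Iic (-1)).Subsingleton := by
      rintro _ ⟨⟨x, hx, rfl⟩, hx0⟩ _ ⟨⟨y, hy, rfl⟩, hy0⟩
      exact hx.zero_eq hω hb (s := Iic (-1)) (F := log) (F' := fun y => y⁻¹)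
        (fun y hy => hlog y (lt_of_le_of_lt (mem_Iic.1 hy) (by norm_num)).ne)
        (Or.inr fun t ht => (strictMonoOn_Ici_strictAntiOn_Iic hodd (hext t ht)).2) hy
        ((hl2 x hx).2.2 hx0) ((hl2 y hy).2.2 hy0)
    have hB : (T ∩ Ioo (-1) 1).Subsingleton := by
      rintro _ ⟨⟨x, hx, rfl⟩, hx0⟩ _ ⟨⟨y, hy, rfl⟩, hy0⟩
      refine hx.zero_eq hω hb (s := Ioo (-1) 1) (F := fun z => (log (1 + z) - log (1 - z)) / 2)
        (F' := fun y => (1 - y ^ 2)⁻¹) (fun z hz => ?_)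
        (hsign.imp
          (fun h t ht => (strictMonoOn_or_strictAntiOn_unit hn (hbn t ht) (hdom t ht)).1 (h t ht))
          (fun h t ht => (strictMonoOn_or_strictAntiOn_unit hn (hbn t ht) (hdom t ht)).2 (h t ht)))
        hy
        (fun t ht => ⟨(hl2 x hx).2.1 hx0.1 t ht, (hl1 x hx).1.1 hx0.2 t ht⟩)
        (fun t ht => ⟨(hl2 y hy).2.1 hy0.1 t ht, (hl1 y hy).1.1 hy0.2 t ht⟩)
      have h1 : 1 + z ≠ 0 := by linarith [hz.1]
      have h2 : 1 - z ≠ 0 := by linarith [hz.2]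
      have h3 : 1 - z ^ 2 ≠ 0 := by
        rw [show 1 - z ^ 2 = (1 + z) * (1 - z) by ring]
        exact mul_ne_zero h1 h2
      refine (((((hasDerivAt_id z).const_add 1).log h1).sub
        (((hasDerivAt_id z).const_sub 1).log h2)).div_const 2).congr_deriv ?_
      simp only [id]
      field_simp
      ring
    have hcover : T ⊆ (T ∩ Ici 1 ∪ T ∩ Ioo (-1) 1) ∪ T ∩ Iic (-1) := by
      intro a ha
      rcases le_or_gt 1 a with h | h
      · exact Or.inl (Or.inl ⟨ha, h⟩)
      · rcases le_or_gt a (-1) with h' | h'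
        · exact Or.inr ⟨ha, h'⟩
        · exact Or.inl (Or.inr ⟨ha, h', h⟩)
    calc T.encard ≤ _ := encard_le_encard hcover
      _ ≤ ((T ∩ Ici 1).encard + (T ∩ Ioo (-1) 1).encard) + (T ∩ Iic (-1)).encard :=
        (encard_union_le _ _).trans (add_le_add_left (encard_union_le _ _) _)
      _ ≤ (1 + 1) + 1 := by
        gcongr
        · exact encard_le_one_iff_subsingleton.2 hA
        · exact encard_le_one_iff_subsingleton.2 hB
        · exact encard_le_one_iff_subsingleton.2 hC
      _ = 3 := by norm_num

/-- The coefficients of the equation after the substitution `x = k * y`. -/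
def scaledCoeff (n : ℕ) (P : Fin n → ℝ → ℝ) (k : ℝ) (i : ℕ) (t : ℝ) : ℝ :=
  (if h : i < n then P ⟨i, h⟩ t else 1) * k ^ i / k

theorem fR_mul (n : ℕ) (P : Fin n → ℝ → ℝ) {k : ℝ} (hk : k ≠ 0) (y t : ℝ) :
    fR n P (k * y) t = k * polyField n (scaledCoeff n P k) t y := by
  rw [fR, polyField, Finset.sum_range_succ, mul_add, add_comm, Finset.sum_range, Finset.mul_sum]
  congr 1
  · refine Finset.sum_congr rfl fun i _ => ?_
    rw [scaledCoeff, dif_pos i.2, mul_pow]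
    field_simp
  · rw [scaledCoeff, dif_neg (lt_irrefl n), mul_pow]
    field_simp

theorem isPeriodicSolR_iff {n : ℕ} {ω : ℝ} {P : Fin n → ℝ → ℝ} {k : ℝ} (hk : k ≠ 0)
    {y : ℝ → ℝ} : IsPeriodicSolR n ω P (fun t => k * y t) ↔
      IsPeriodicOrbit ω (polyField n (scaledCoeff n P k)) y := by
  refine and_congr (forall₂_congr fun t _ => ?_) (mul_right_inj' hk)
  rw [fR_mul n P hk]
  refine ⟨fun h => ?_, fun h => h.const_mul k⟩
  simpa [← mul_assoc, inv_mul_cancel₀ hk] using h.const_mul k⁻¹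

theorem continuousOn_scaledCoeff {n : ℕ} {P : Fin n → ℝ → ℝ} {s : Set ℝ}
    (hP : ∀ i, ContinuousOn (P i) s) (k : ℝ) (i : ℕ) :
    ContinuousOn (scaledCoeff n P k i) s := by
  unfold scaledCoeff
  split_ifs <;> fun_prop

theorem exists_radius_of_two_le {N : ℕ} (hN : 2 ≤ N) : ∃ c : ℝ, 0 < c ∧ c ≤ 1 ∧
    c ^ (N + 3) ≤ (N + 2) / (N + 3) ∧ (N + 3) / (2 * (N + 2)) < c ^ (N + 3) ∧
    c ^ (N + 5) ≤ 2 * c - 1 ∧ 1 / 2 ≤ c ^ (N + 5) := by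
  have hN' : (2:ℝ) ≤ N := by exact_mod_cast hN
  set δ : ℝ := 1 / (2 * (N + 5)) with hδ
  have hδ0 : 0 < δ := by positivity
  have hδ1 : δ < 1 := by rw [hδ, div_lt_one (by positivity)]; linarith
  have hlow : ∀ m : ℕ, 1 - m * δ ≤ (1 - δ) ^ m := fun m => by
    have := one_add_mul_le_pow (a := -δ) (by linarith) m
    rw [← sub_eq_add_neg] at this
    linarith
  have hup : (1 - δ) ^ (N + 3) ≤ (N + 2) / (N + 3) := by
    have h1 : 1 + ((N + 3 : ℕ) : ℝ) * (1 / (2 * N + 9)) ≤ (1 + 1 / (2 * N + 9)) ^ (N + 3) :=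
      one_add_mul_le_pow (by have : (0:ℝ) ≤ 1 / (2 * N + 9) := by positivity
                             linarith) _
    have h2 : 1 - δ = (1 + 1 / (2 * (N:ℝ) + 9))⁻¹ := by
      rw [hδ]; field_simp; ring
    rw [h2, inv_pow, ← inv_div ((N:ℝ) + 3) ((N:ℝ) + 2)]
    refine inv_anti₀ (by positivity) (le_trans ?_ h1)
    push_cast
    rw [div_le_iff₀ (by positivity)]
    field_simp
    nlinarith
  refine ⟨1 - δ, by linarith, by linarith, hup, ?_, ?_, ?_⟩
  · refine lt_of_lt_of_le ?_ (hlow (N + 3))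
    rw [hδ]
    push_cast
    rw [div_lt_iff₀ (by positivity)]
    field_simp
    nlinarith
  · have h1 : (1 - δ) ^ (N + 5) ≤ (1 - δ) ^ (N + 3) :=
      pow_le_pow_of_le_one (by linarith) (by linarith) (by omega)
    refine h1.trans (hup.trans ?_)
    rw [hδ, div_le_iff₀ (by positivity)]
    field_simp
    nlinarith
  · refine le_trans (le_of_eq ?_) (hlow (N + 5))
    rw [hδ]
    push_cast
    field_simp
    norm_num

theorem exists_radius {N : ℕ} (hN : N ≠ 1) : ∃ c : ℝ, 0 < c ∧ c ≤ 1 ∧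
    c ^ (N + 5) + 1 ≤ 2 * c ∧
    c ^ (N + 5) + (∑ j ∈ Finset.range (N + 3), c ^ (j + 2)) / (N + 2) ≤ 2 * c ∧
    (∑ j ∈ Finset.range (N + 3), ((j:ℝ) + 1) * c ^ (j + 2)) / (N + 2) < (N + 4) * c ^ (N + 5) ∧
    1 < (N + 4) * c ^ (N + 5) := by
  rcases Nat.eq_zero_or_pos N with rfl | hpos
  · exact ⟨9 / 10, by norm_num, by norm_num, by norm_num, by norm_num [Finset.sum_range_succ],
      by norm_num [Finset.sum_range_succ], by norm_num⟩
  obtain ⟨c, hc0, hc1, hup, hlow, h1, h2⟩ := exists_radius_of_two_le (N := N) (by omega)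
  have hle : ∀ j : ℕ, c ^ (j + 2) ≤ c ^ 2 := fun j => pow_le_pow_of_le_one hc0.le hc1 (by omega)
  have hN2 : (0:ℝ) < N + 2 := by positivity
  refine ⟨c, hc0, hc1, by linarith, ?_, ?_, ?_⟩
  · have hsum : ∑ j ∈ Finset.range (N + 3), c ^ (j + 2) ≤ (N + 2) * c ^ 2 + c ^ (N + 4) := by
      rw [Finset.sum_range_succ]
      refine add_le_add_left ((Finset.sum_le_sum fun j _ => hle j).trans_eq ?_) _
      simp
    have hu : c ^ (N + 4) = c * c ^ (N + 3) := by ring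
    have hv : c ^ (N + 5) ≤ c * c ^ (N + 3) := by
      rw [← hu]; exact pow_le_pow_of_le_one hc0.le hc1 (by omega)
    have hdiv : (∑ j ∈ Finset.range (N + 3), c ^ (j + 2)) / (N + 2)
        ≤ c ^ 2 + c * c ^ (N + 3) / (N + 2) := by
      rw [div_le_iff₀ hN2]
      refine hsum.trans_eq ?_
      rw [hu]
      field_simp
    have hone : c ^ (N + 3) + c ^ (N + 3) / (N + 2) ≤ 1 := by
      have : c ^ (N + 3) + c ^ (N + 3) / (N + 2) = c ^ (N + 3) * ((N + 3) / (N + 2)) := by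
        field_simp; ring
      rw [this]
      refine (mul_le_mul_of_nonneg_right hup (by positivity)).trans_eq ?_
      field_simp
    have hm := mul_le_mul_of_nonneg_left hone hc0.le
    have hcc : c ^ 2 ≤ c := by nlinarith
    rw [mul_add, ← mul_div_assoc] at hm
    linarith
  · have hsum : ∑ j ∈ Finset.range (N + 3), ((j:ℝ) + 1) * c ^ (j + 2)
        ≤ (N + 3) * (N + 4) / 2 * c ^ 2 := by
      have hg : ∀ m : ℕ, ∑ j ∈ Finset.range m, ((j:ℝ) + 1) = m * (m + 1) / 2 := fun m => by
        induction m with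
        | zero => simp
        | succ m ih => rw [Finset.sum_range_succ, ih]; push_cast; ring
      calc ∑ j ∈ Finset.range (N + 3), ((j:ℝ) + 1) * c ^ (j + 2)
          ≤ ∑ j ∈ Finset.range (N + 3), ((j:ℝ) + 1) * c ^ 2 :=
            Finset.sum_le_sum fun j _ => mul_le_mul_of_nonneg_left (hle j) (by positivity)
        _ = _ := by rw [← Finset.sum_mul, hg]; push_cast; ring
    rw [div_lt_iff₀ hN2]
    rw [div_lt_iff₀ (by positivity)] at hlow
    have hpos' : (0:ℝ) < (N + 4) / 2 * c ^ 2 := by positivity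
    have := mul_lt_mul_of_pos_left hlow hpos'
    calc _ ≤ _ := hsum
      _ = (N + 4) / 2 * c ^ 2 * (N + 3) := by ring
      _ < _ := this
      _ = _ := by ring
  · have : (0:ℝ) ≤ N := N.cast_nonneg
    nlinarith

theorem sum_erase_one_le {N : ℕ} {a : ℕ → ℝ} {m c : ℝ}
    (ha : ∀ j < N + 3, |a (j + 2)| ≤ m * c ^ (j + 2)) :
    ∑ i ∈ (Finset.range (N + 5 + 1)).erase 1, |a i| ≤
      |a 0| + m * ∑ j ∈ Finset.range (N + 3), c ^ (j + 2) + |a (N + 5)| := by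
  have h := Finset.add_sum_erase (Finset.range (N + 5 + 1)) (fun i => |a i|)
    (show 1 ∈ Finset.range (N + 5 + 1) by simp)
  rw [Finset.sum_range_succ, Finset.sum_range_succ', Finset.sum_range_succ'] at h
  have hle := Finset.sum_le_sum fun j hj => ha j (Finset.mem_range.1 hj)
  rw [← Finset.mul_sum] at hle
  simp only [add_assoc, Nat.reduceAdd, zero_add] at h hle ⊢
  linarith

theorem sum_sub_one_mul_le {N : ℕ} {a : ℕ → ℝ} {m c : ℝ}
    (ha : ∀ j < N + 3, |a (j + 2)| ≤ m * c ^ (j + 2)) :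
    ∑ i ∈ Finset.range (N + 5), |((i:ℝ) - 1) * a i| ≤
      |a 0| + m * ∑ j ∈ Finset.range (N + 3), ((j:ℝ) + 1) * c ^ (j + 2) := by
  rw [Finset.sum_range_succ', Finset.sum_range_succ', Finset.mul_sum]
  have hle : ∑ j ∈ Finset.range (N + 3), |(((j + 1 + 1 : ℕ) : ℝ) - 1) * a (j + 1 + 1)| ≤
      ∑ j ∈ Finset.range (N + 3), m * (((j:ℝ) + 1) * c ^ (j + 2)) := by
    refine Finset.sum_le_sum fun j hj => ?_
    have hj1 : (((j + 1 + 1 : ℕ) : ℝ) - 1) = (j:ℝ) + 1 := by push_cast; ring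
    rw [hj1, abs_mul, abs_of_nonneg (by positivity : (0:ℝ) ≤ (j:ℝ) + 1)]
    refine (mul_le_mul_of_nonneg_left (ha j (Finset.mem_range.1 hj)) (by positivity)).trans_eq ?_
    ring
  simp only [zero_add, Nat.cast_one, sub_self, zero_mul, abs_zero, add_zero, Nat.cast_zero,
    zero_sub, neg_mul, one_mul, abs_neg]
  linarith

/-- Both dominance conditions hold in the scaled coordinate when the linear coefficient exceeds
`K + p + D * s`, the middle ones are at most `D * s / (N + 2)` and the leading one is
`K = p + D`, up to the common factor `l`. -/
theorem dominance_of_bounds {N : ℕ} {a : ℕ → ℝ} {c p D s l : ℝ} (hc0 : 0 < c) (hcle : c ≤ 1)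
    (hl : 0 < l) (hp : 0 ≤ p) (hD : 0 < D) (hs0 : 0 ≤ s) (hs1 : s ≤ 1)
    (hc1 : c ^ (N + 5) + 1 ≤ 2 * c)
    (hc2 : c ^ (N + 5) + (∑ j ∈ Finset.range (N + 3), c ^ (j + 2)) / (N + 2) ≤ 2 * c)
    (hc3 : (∑ j ∈ Finset.range (N + 3), ((j:ℝ) + 1) * c ^ (j + 2)) / (N + 2)
      < (N + 4) * c ^ (N + 5))
    (hc4 : 1 < (N + 4) * c ^ (N + 5))
    (h0 : |a 0| = p * l) (h1 : (p + D + p + D * s) * c * l ≤ |a 1|)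
    (hmid : ∀ j < N + 3, |a (j + 2)| ≤ D * s / (N + 2) * l * c ^ (j + 2))
    (htop : a (N + 5) = (p + D) * c ^ (N + 5) * l) :
    ∑ i ∈ (Finset.range (N + 5 + 1)).erase 1, |a i| ≤ |a 1| ∧
    ∑ i ∈ Finset.range (N + 5), |((i:ℝ) - 1) * a i| < (((N + 5 : ℕ) : ℝ) - 1) * a (N + 5) := by
  constructor
  · refine (sum_erase_one_le hmid).trans (le_trans ?_ h1)
    rw [h0, htop, abs_of_pos (by positivity)]
    set M := (∑ j ∈ Finset.range (N + 3), c ^ (j + 2)) / ((N:ℝ) + 2) with hM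
    have hsum : D * s / (N + 2) * l * ∑ j ∈ Finset.range (N + 3), c ^ (j + 2) = D * s * M * l := by
      rw [hM]; ring
    rw [hsum]
    have hcc : c ^ (N + 5) ≤ c := pow_le_of_le_one hc0.le hcle (by omega)
    have e1 := mul_nonneg hp (sub_nonneg.2 hc1)
    have e2 := mul_nonneg (mul_nonneg hD.le hs0) (sub_nonneg.2 hc2)
    have e3 := mul_nonneg (mul_nonneg hD.le (sub_nonneg.2 hs1)) (sub_nonneg.2 hcc)
    rw [← sub_nonneg]
    have := mul_nonneg (add_nonneg (add_nonneg e1 e2) e3) hl.le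
    refine this.trans_eq ?_
    ring
  · refine (sum_sub_one_mul_le hmid).trans_lt ?_
    rw [h0, htop]
    set M := (∑ j ∈ Finset.range (N + 3), ((j:ℝ) + 1) * c ^ (j + 2)) / ((N:ℝ) + 2) with hM
    have hM0 : 0 ≤ M := by positivity
    have hsum : D * s / (N + 2) * l * ∑ j ∈ Finset.range (N + 3), ((j:ℝ) + 1) * c ^ (j + 2)
        = D * (s * M) * l := by
      rw [hM]; ring
    rw [hsum]
    have e1 := mul_nonneg hp (sub_nonneg.2 hc4.le)
    have e2 := mul_pos hD (sub_pos.2 ((mul_le_of_le_one_left hM0 hs1).trans_lt hc3))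
    rw [← sub_pos]
    have := mul_pos (add_pos_of_nonneg_of_pos e1 e2) hl
    refine this.trans_eq ?_
    push_cast
    ring

/-- Theorem 1.1 (real part, `n` odd): under the stated bounds (for every `i ≠ 0, 1`,
including `i = n-1`), with `n ≥ 5` odd, equation (1.1) has at least one and at most
three real periodic solutions. -/
theorem theorem_1_1_real_count_odd
    {n : ℕ} (hn : 5 ≤ n) (hodd : Odd n) {ω : ℝ} (hω : 0 < ω)
    (P : Fin n → ℝ → ℝ) (hP : ∀ i, ContinuousOn (P i) (Icc 0 ω))
    (K : ℝ) (hK : ∀ t ∈ Icc (0:ℝ) ω, |P ⟨0, by omega⟩ t| < K)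
    (ha : ∀ t ∈ Icc (0:ℝ) ω, ∀ i : Fin n, (i:ℕ) ≠ 0 → (i:ℕ) ≠ 1 →
      |P i t| ≤ (K - |P ⟨0, by omega⟩ t|) * sin (π / ((n:ℝ) - 2)) /
        (((n:ℝ) - 3) * K ^ (((i:ℕ):ℝ) / (n:ℝ))))
    (hb : ∀ t ∈ Icc (0:ℝ) ω,
      (K + |P ⟨0, by omega⟩ t| + |P ⟨n-1, by omega⟩ t| +
          (K - |P ⟨0, by omega⟩ t|) * sin (π / ((n:ℝ) - 2)))
        / K ^ ((1:ℝ) / (n:ℝ)) ≤ |P ⟨1, by omega⟩ t|) :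
    (∃ x : ℝ → ℝ, IsPeriodicSolR n ω P x) ∧
    (∃ S : Finset ℝ, S.card ≤ 3 ∧ ∀ x : ℝ → ℝ, IsPeriodicSolR n ω P x → x 0 ∈ S) := by
  obtain ⟨N, rfl⟩ := Nat.exists_eq_add_of_le' hn
  have hK0 : 0 < K := (abs_nonneg _).trans_lt (hK 0 ⟨le_rfl, hω.le⟩)
  obtain ⟨c, hc0, hcle, hc1, hc2, hc3, hc4⟩ := exists_radius (N := N) (by
    rintro rfl; revert hodd; decide)
  set κ : ℝ := K ^ ((1:ℝ) / ((N + 5 : ℕ) : ℝ)) with hκ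
  have hκ0 : 0 < κ := rpow_pos_of_pos hK0 _
  have hκpow : ∀ i : ℕ, K ^ ((i:ℝ) / ((N + 5 : ℕ) : ℝ)) = κ ^ i := fun i => by
    rw [hκ, ← rpow_natCast, ← rpow_mul hK0.le, one_div_mul_eq_div]
  have hκn : κ ^ (N + 5) = K := by
    rw [← hκpow, div_self (by positivity), rpow_one]
  set k := κ * c with hk
  have hk0 : 0 < k := mul_pos hκ0 hc0
  set s := sin (π / (((N + 5 : ℕ) : ℝ) - 2)) with hs
  have hs0 : 0 ≤ s := by
    have h3 : (1:ℝ) ≤ ((N + 5 : ℕ) : ℝ) - 2 := by push_cast; linarith [N.cast_nonneg (α := ℝ)]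
    exact sin_nonneg_of_nonneg_of_le_pi (div_nonneg pi_pos.le (by linarith))
      (div_le_self pi_pos.le h3)
  have hdom : ∀ t ∈ Icc (0:ℝ) ω, _ := fun t ht =>
    dominance_of_bounds (N := N) (a := fun i => scaledCoeff (N + 5) P k i t)
      (p := |P ⟨0, by omega⟩ t|) (D := K - |P ⟨0, by omega⟩ t|) (l := k⁻¹)
      hc0 hcle (inv_pos.2 hk0) (abs_nonneg _) (sub_pos.2 (hK t ht)) hs0 (sin_le_one _)
      hc1 hc2 hc3 hc4
      (by simp [scaledCoeff, abs_of_pos hk0, div_eq_mul_inv])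
      (by
        have h := hb t ht
        rw [div_le_iff₀ hκ0] at h
        have h' : K + |P ⟨0, by omega⟩ t| + (K - |P ⟨0, by omega⟩ t|) * s
            ≤ |P ⟨1, by omega⟩ t| * κ := by
          linarith [abs_nonneg (P ⟨N + 5 - 1, by omega⟩ t)]
        rw [scaledCoeff, dif_pos (by omega), pow_one, div_eq_mul_inv, abs_mul, abs_mul,
          abs_of_pos hk0, abs_of_pos (inv_pos.2 hk0)]
        refine mul_le_mul_of_nonneg_right ?_ (inv_pos.2 hk0).le
        rw [hk, ← mul_assoc]
        refine mul_le_mul_of_nonneg_right ?_ hc0.le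
        linarith)
      (fun j hj => by
        have h := ha t ht ⟨j + 2, by omega⟩ (by simp) (by simp)
        rw [hκpow] at h
        have h3 : ((N + 5 : ℕ) : ℝ) - 3 = N + 2 := by push_cast; ring
        rw [h3, ← div_div, le_div_iff₀ (by positivity)] at h
        rw [scaledCoeff, dif_pos (by omega), div_eq_mul_inv, abs_mul, abs_mul, abs_pow,
          abs_of_pos hk0, abs_of_pos (inv_pos.2 hk0), mul_right_comm _ k⁻¹]
        refine mul_le_mul_of_nonneg_right ?_ (inv_pos.2 hk0).le
        rw [hk, mul_pow, ← mul_assoc]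
        exact mul_le_mul_of_nonneg_right h (by positivity))
      (by simp [scaledCoeff, hk, mul_pow, hκn, div_eq_mul_inv])
  obtain ⟨⟨y, hy⟩, hcard⟩ := exists_and_encard_isPeriodicOrbit_polyField (n := N + 5) (by omega)
    hodd hω (b := scaledCoeff (N + 5) P k) (continuousOn_scaledCoeff hP k)
    (fun t _ => by simp [scaledCoeff]; positivity)
    (fun t ht => (hdom t ht).1) (fun t ht => (hdom t ht).2)
  refine ⟨⟨_, (isPeriodicSolR_iff hk0.ne').2 hy⟩, ?_⟩
  obtain ⟨hfin, hncard⟩ := encard_le_coe_iff_finite_ncard_le.1 hcard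
  refine ⟨hfin.toFinset.image (k * ·),
    Finset.card_image_le.trans (by rwa [← ncard_eq_toFinset_card _ hfin]), fun x hx => ?_⟩
  have hxk : (fun t => k * (k⁻¹ * x t)) = x := funext fun t => mul_inv_cancel_left₀ hk0.ne' _
  rw [Finset.mem_image]
  refine ⟨k⁻¹ * x 0, hfin.mem_toFinset.2 ⟨fun t => k⁻¹ * x t, ?_, rfl⟩,
    mul_inv_cancel_left₀ hk0.ne' _⟩
  rw [← isPeriodicSolR_iff hk0.ne', hxk]
  exact hx
end
end
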